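/- There exist a constant C and a real number x₀ such that for every real x ≥ x₀ and every completely multiplicative function f with -1 ≤ f(n) ≤ 1 for all positive integers n, one has | ∑_{d ≤ x} f(d){x/d} − ( ∑_{n ≤ x} f(n) ) · ∑_{j ≤ log x} ( log((j+1)/j) − 1/(j+1) ) | ≤ C x (log log x)² / (log x)^{1/4}, where {t} denotes the fractional part of t. -/

import Mathlib

/-- A completely multiplicative function `f : ℕ → ℝ` (on positive integers):
`f 1 = 1` and `f (m * n) = f m * f n` for all positive `m, n`. -/
def IsComplMult (f : ℕ → ℝ) : Prop :=
  f 1 = 1 ∧ ∀ m n : ℕ, 0 < m → 0 < n → f (m * n) = f m * f n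

open MeasureTheory FourierTransform ContDiff in
theorem fourier_toLp_ae_eq {f : ℝ → ℂ} (h1 : Integrable f) (h2 : MemLp f 2) :
    ((𝓕 (h2.toLp f) : Lp ℂ 2 (volume : Measure ℝ)) : ℝ → ℂ) =ᵐ[volume] 𝓕 f := by
  have hcont : Continuous (𝓕 f) :=
    VectorFourier.fourierIntegral_continuous Real.continuous_fourierChar continuous_inner h1
  apply ae_eq_of_integral_contDiff_smul_eq
  · exact (Lp.memLp _).locallyIntegrable (by norm_num)
  · exact hcont.locallyIntegrable
  · intro g g_smooth g_cpt
    have hg₁ : HasCompactSupport (Complex.ofRealCLM ∘ g) := g_cpt.comp_left rfl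
    have hg₂ : ContDiff ℝ ∞ (Complex.ofRealCLM ∘ g) := by fun_prop
    set G : SchwartzMap ℝ ℂ := hg₁.toSchwartzMap hg₂ with hG
    have hGapp : ∀ x, G x = (g x : ℂ) := fun x => rfl
    have e1 : Lp.toTemperedDistribution (𝓕 (h2.toLp f)) G
        = Lp.toTemperedDistribution (h2.toLp f) (𝓕 G) := by
      rw [← Lp.fourier_toTemperedDistribution_eq]
      rfl
    rw [Lp.toTemperedDistribution_apply, Lp.toTemperedDistribution_apply] at e1
    have e2 : ∫ x, G x • (𝓕 f) x = ∫ x, (𝓕 G) x • f x := by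
      have := VectorFourier.integral_fourierIntegral_smul_eq_flip (L := innerₗ ℝ) (μ := volume)
        (ν := volume) (f := fun x => G x) (g := f) Real.continuous_fourierChar continuous_inner
        G.integrable h1
      rw [flip_innerₗ] at this
      exact this.symm
    have e3 : ∫ x, (𝓕 G) x • (h2.toLp f) x = ∫ x, (𝓕 G) x • f x := by
      apply integral_congr_ae
      filter_upwards [h2.coeFn_toLp] with x hx
      rw [hx]
    rw [e3, ← e2] at e1
    simpa [hGapp] using e1

open MeasureTheory FourierTransform ContDiff in
theorem memLp_fourier {f : ℝ → ℂ} (h1 : Integrable f) (h2 : MemLp f 2) : MemLp (𝓕 f) 2 :=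
  (memLp_congr_ae (fourier_toLp_ae_eq h1 h2)).mp (Lp.memLp _)

open MeasureTheory FourierTransform ContDiff in
theorem integral_norm_sq_fourier {f : ℝ → ℂ} (h1 : Integrable f) (h2 : MemLp f 2) :
    ∫ ξ, ‖𝓕 f ξ‖ ^ 2 = ∫ x, ‖f x‖ ^ 2 := by
  have key : ∀ g : Lp ℂ 2 (volume : Measure ℝ), ∫ x, ‖g x‖ ^ 2 = ‖g‖ ^ 2 := by
    intro g
    have := L2.inner_def (𝕜 := ℂ) g g
    rw [inner_self_eq_norm_sq_to_K] at this
    have h3 : ∀ x, inner ℂ (g x) (g x) = ((‖g x‖ ^ 2 : ℝ) : ℂ) := fun x => by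
      rw [inner_self_eq_norm_sq_to_K]; norm_cast
    simp_rw [h3] at this
    rw [integral_complex_ofReal] at this
    apply Complex.ofReal_injective
    rw [← this]
    push_cast
    rfl
  have a1 : ∫ ξ, ‖𝓕 f ξ‖ ^ 2 = ∫ ξ, ‖(𝓕 (h2.toLp f) : Lp ℂ 2 (volume : Measure ℝ)) ξ‖ ^ 2 := by
    apply integral_congr_ae
    filter_upwards [fourier_toLp_ae_eq h1 h2] with x hx
    rw [hx]
  have a2 : ∫ ξ, ‖f ξ‖ ^ 2 = ∫ ξ, ‖(h2.toLp f) ξ‖ ^ 2 := by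
    apply integral_congr_ae
    filter_upwards [h2.coeFn_toLp] with x hx
    rw [hx]
  rw [a1, a2, key, key, Lp.norm_fourier_eq]

/-- The summatory function of `a` at `exp y`, damped by the factor `exp (-c * y)`. -/
noncomputable def expMean (a : ℕ → ℂ) (c y : ℝ) : ℂ :=
  (∑ n ∈ Finset.Icc 1 ⌊Real.exp y⌋₊, a n) * (Real.exp (-c * y) : ℝ)

theorem expMean_of_neg (a : ℕ → ℂ) (c : ℝ) {y : ℝ} (hy : y < 0) : expMean a c y = 0 := by
  have : ⌊Real.exp y⌋₊ = 0 := Nat.floor_eq_zero.mpr (Real.exp_lt_one_iff.mpr hy)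
  simp [expMean, this]

theorem measurable_expMean (a : ℕ → ℂ) (c : ℝ) : Measurable (expMean a c) := by
  unfold expMean
  have h : Measurable (fun y : ℝ => ∑ n ∈ Finset.Icc 1 ⌊Real.exp y⌋₊, a n) :=
    (measurable_from_top (f := fun N : ℕ => ∑ n ∈ Finset.Icc 1 N, a n)).comp
      (Nat.measurable_floor.comp Real.measurable_exp)
  fun_prop

theorem norm_expMean_le {a : ℕ → ℂ} {C σ : ℝ}
    (ha : ∀ N : ℕ, ∑ n ∈ Finset.Icc 1 N, ‖a n‖ ≤ C * (N : ℝ) ^ (1 + σ / 2)) (hσ : 0 < σ) (y : ℝ) :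
    ‖expMean a (1 + σ) y‖ ≤ (Set.Ici 0).indicator (fun y => C * Real.exp (-(σ / 2) * y)) y := by
  have hC : 0 ≤ C := by
    have := ha 1
    simp only [Nat.cast_one, Real.one_rpow, mul_one] at this
    exact le_trans (Finset.sum_nonneg fun _ _ => norm_nonneg _) this
  rcases lt_or_ge y 0 with hy | hy
  · rw [expMean_of_neg _ _ hy, norm_zero, Set.indicator_of_notMem (by simpa using hy)]
  · rw [Set.indicator_of_mem (by simpa using hy)]
    unfold expMean
    rw [norm_mul, Complex.norm_real, Real.norm_of_nonneg (Real.exp_pos _).le]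
    calc _ ≤ (C * (Real.exp y) ^ (1 + σ / 2)) * Real.exp (-(1 + σ) * y) := by
          gcongr
          refine (norm_sum_le _ _).trans ((ha _).trans ?_)
          gcongr
          exact Nat.floor_le (Real.exp_pos _).le
      _ = _ := by
          rw [← Real.exp_mul, mul_assoc, ← Real.exp_add]
          ring_nf

open MeasureTheory in
theorem integrable_indicator_exp {b : ℝ} (hb : 0 < b) (C : ℝ) :
    Integrable ((Set.Ici (0 : ℝ)).indicator (fun y => C * Real.exp (-b * y))) := by
  rw [integrable_indicator_iff measurableSet_Ici, integrableOn_Ici_iff_integrableOn_Ioi]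
  exact (integrableOn_exp_mul_Ioi (by linarith) 0).const_mul C

open MeasureTheory in
theorem integral_indicator_exp {b : ℝ} (hb : 0 < b) (C : ℝ) :
    ∫ y, (Set.Ici (0 : ℝ)).indicator (fun y => C * Real.exp (-b * y)) y = C / b := by
  rw [integral_indicator measurableSet_Ici, integral_Ici_eq_integral_Ioi, integral_const_mul,
    integral_exp_mul_Ioi (by linarith)]
  simp
  field_simp

open MeasureTheory in
theorem integrable_expMean {a : ℕ → ℂ} {C σ : ℝ}
    (ha : ∀ N : ℕ, ∑ n ∈ Finset.Icc 1 N, ‖a n‖ ≤ C * (N : ℝ) ^ (1 + σ / 2)) (hσ : 0 < σ) :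
    Integrable (expMean a (1 + σ)) :=
  (integrable_indicator_exp (half_pos hσ) C).mono' (measurable_expMean _ _).aestronglyMeasurable
    (ae_of_all _ (norm_expMean_le ha hσ))

theorem norm_sq_expMean_le {a : ℕ → ℂ} {C σ : ℝ}
    (ha : ∀ N : ℕ, ∑ n ∈ Finset.Icc 1 N, ‖a n‖ ≤ C * (N : ℝ) ^ (1 + σ / 2)) (hσ : 0 < σ) (y : ℝ) :
    ‖expMean a (1 + σ) y‖ ^ 2 ≤ (Set.Ici 0).indicator (fun y => C ^ 2 * Real.exp (-σ * y)) y := by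
  have h := norm_expMean_le ha hσ y
  by_cases hy : y ∈ Set.Ici (0 : ℝ)
  · rw [Set.indicator_of_mem hy] at h ⊢
    calc _ ≤ (C * Real.exp (-(σ / 2) * y)) ^ 2 := by gcongr
      _ = _ := by rw [mul_pow, ← Real.exp_nat_mul]; push_cast; ring_nf
  · rw [Set.indicator_of_notMem hy] at h ⊢
    have : ‖expMean a (1 + σ) y‖ = 0 := le_antisymm h (norm_nonneg _)
    rw [this]; norm_num

open MeasureTheory in
theorem integrable_norm_sq_expMean {a : ℕ → ℂ} {C σ : ℝ}
    (ha : ∀ N : ℕ, ∑ n ∈ Finset.Icc 1 N, ‖a n‖ ≤ C * (N : ℝ) ^ (1 + σ / 2)) (hσ : 0 < σ) :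
    Integrable (fun y => ‖expMean a (1 + σ) y‖ ^ 2) :=
  (integrable_indicator_exp hσ (C ^ 2)).mono'
    ((measurable_expMean _ _).norm.pow_const 2).aestronglyMeasurable
    (ae_of_all _ fun y => by
      rw [Real.norm_of_nonneg (by positivity)]; exact norm_sq_expMean_le ha hσ y)

open MeasureTheory in
theorem memLp_expMean {a : ℕ → ℂ} {C σ : ℝ}
    (ha : ∀ N : ℕ, ∑ n ∈ Finset.Icc 1 N, ‖a n‖ ≤ C * (N : ℝ) ^ (1 + σ / 2)) (hσ : 0 < σ) :
    MemLp (expMean a (1 + σ)) 2 :=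
  (memLp_two_iff_integrable_sq_norm (measurable_expMean _ _).aestronglyMeasurable).mpr
    (integrable_norm_sq_expMean ha hσ)

open MeasureTheory in
theorem integral_norm_sq_expMean_le {a : ℕ → ℂ} {C σ : ℝ}
    (ha : ∀ N : ℕ, ∑ n ∈ Finset.Icc 1 N, ‖a n‖ ≤ C * (N : ℝ) ^ (1 + σ / 2)) (hσ : 0 < σ) :
    ∫ y, ‖expMean a (1 + σ) y‖ ^ 2 ≤ C ^ 2 / σ := by
  rw [← integral_indicator_exp hσ]
  exact integral_mono (integrable_norm_sq_expMean ha hσ) (integrable_indicator_exp hσ _)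
    (norm_sq_expMean_le ha hσ)

open MeasureTheory FourierTransform in
theorem fourier_expMean {a : ℕ → ℂ} {C σ : ℝ}
    (ha : ∀ N : ℕ, ∑ n ∈ Finset.Icc 1 N, ‖a n‖ ≤ C * (N : ℝ) ^ (1 + σ / 2)) (hσ : 0 < σ) (ξ : ℝ) :
    (1 + σ + 2 * Real.pi * ξ * Complex.I) * 𝓕 (expMean a (1 + σ)) ξ
      = LSeries a (1 + σ + 2 * Real.pi * ξ * Complex.I) := by
  set s : ℂ := 1 + σ + 2 * Real.pi * ξ * Complex.I with hs
  have hre : s.re = 1 + σ := by simp [hs]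
  rw [LSeries_eq_mul_integral' a (r := 1 + σ / 2) (by positivity) (by rw [hre]; linarith)
    (Asymptotics.IsBigO.of_bound C (Filter.Eventually.of_forall fun N => ?_))]
  · congr 1
    rw [show Set.Ioi (1 : ℝ) = Set.Ioi (Real.exp 0) by simp, ← integral_comp_exp_Ioi,
      Real.fourier_real_eq_integral_exp_smul,
      ← setIntegral_eq_integral_of_ae_compl_eq_zero (s := Set.Ioi 0)]
    · refine setIntegral_congr_fun measurableSet_Ioi fun y _ => ?_
      have h1 : ((Real.exp y : ℝ) : ℂ) ^ (-(s + 1)) = Complex.exp (y * (-(s + 1))) := by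
        rw [Complex.cpow_def_of_ne_zero (by exact_mod_cast (Real.exp_pos y).ne'),
          ← Complex.ofReal_log (Real.exp_pos y).le, Real.log_exp]
      simp only [expMean, smul_eq_mul, h1, Complex.real_smul]
      rw [mul_left_comm, mul_left_comm (Complex.ofReal (Real.exp y))]
      congr 1
      rw [Complex.ofReal_exp, Complex.ofReal_exp, ← Complex.exp_add, ← Complex.exp_add, hs]
      congr 1
      push_cast
      ring
    · have : ∀ᵐ y : ℝ, y ≠ 0 := by simp [ae_iff]
      filter_upwards [this] with y hy hy2
      rw [expMean_of_neg, smul_zero]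
      exact lt_of_le_of_ne (by simpa using hy2) hy
  · rw [Real.norm_of_nonneg (Finset.sum_nonneg fun _ _ => norm_nonneg _),
      Real.norm_of_nonneg (by positivity)]
    exact ha N

theorem abs_re_le_of_norm_eq_one {v : ℂ} (hv : ‖v‖ = 1) :
    |v.re| ≤ 17 / 24 + 1 / 3 * (v ^ 2).re := by
  have h1 : v.re ^ 2 + v.im ^ 2 = 1 := by
    have := Complex.sq_norm v
    rw [hv, Complex.normSq_apply] at this
    nlinarith
  have h2 : (v ^ 2).re = v.re ^ 2 - v.im ^ 2 := by simp [pow_two]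
  rw [h2]
  nlinarith [sq_nonneg (|v.re| - 3 / 4), sq_abs v.re]

theorem re_neg_log_one_sub_le {a r : ℝ} {u : ℂ} (ha : |a| ≤ 1) (hr0 : 0 ≤ r) (hr1 : r < 1)
    (hu : ‖u‖ = 1) :
    (-Complex.log (1 - a * (r * u))).re ≤ 17 / 24 * (-Complex.log (1 - r)).re
      + 1 / 3 * (-Complex.log (1 - r * u ^ 2)).re := by
  have n1 : ‖(a : ℂ) * (r * u)‖ < 1 := by
    rw [norm_mul, norm_mul, hu, Complex.norm_real, Complex.norm_real, Real.norm_eq_abs,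
      Real.norm_of_nonneg hr0]
    nlinarith [abs_nonneg a]
  have n2 : ‖(r : ℂ)‖ < 1 := by rwa [Complex.norm_real, Real.norm_of_nonneg hr0]
  have n3 : ‖(r : ℂ) * u ^ 2‖ < 1 := by
    rw [norm_mul, norm_pow, hu, one_pow, mul_one]; exact n2
  have s1 := Complex.hasSum_re (Complex.hasSum_taylorSeries_neg_log n1)
  have s2 := Complex.hasSum_re (Complex.hasSum_taylorSeries_neg_log n2)
  have s3 := Complex.hasSum_re (Complex.hasSum_taylorSeries_neg_log n3)
  refine hasSum_le (fun n => ?_) s1 ((s2.mul_left (17 / 24)).add (s3.mul_left (1 / 3)))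
  simp only [Complex.div_natCast_re]
  have hv : ‖u ^ n‖ = 1 := by rw [norm_pow, hu, one_pow]
  have key := abs_re_le_of_norm_eq_one hv
  have e1 : (((a : ℂ) * (r * u)) ^ n).re = a ^ n * r ^ n * (u ^ n).re := by
    rw [show ((a : ℂ) * (r * u)) ^ n = ((a ^ n * r ^ n : ℝ) : ℂ) * u ^ n by push_cast; ring,
      Complex.re_ofReal_mul]
  have e2 : ((r : ℂ) ^ n).re = r ^ n := by
    rw [← Complex.ofReal_pow, Complex.ofReal_re]
  have e3 : (((r : ℂ) * u ^ 2) ^ n).re = r ^ n * ((u ^ n) ^ 2).re := by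
    rw [show ((r : ℂ) * u ^ 2) ^ n = ((r ^ n : ℝ) : ℂ) * (u ^ n) ^ 2 by push_cast; ring,
      Complex.re_ofReal_mul]
  rw [e1, e2, e3, ← mul_div_assoc, ← mul_div_assoc, ← add_div]
  gcongr
  have h4 : a ^ n * (u ^ n).re ≤ |(u ^ n).re| := by
    refine (le_abs_self _).trans ?_
    rw [abs_mul, abs_pow]
    exact mul_le_of_le_one_left (abs_nonneg _) (pow_le_one₀ (abs_nonneg _) ha)
  have := mul_le_mul_of_nonneg_left (h4.trans key) (pow_nonneg hr0 n)
  linarith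

/-- The completely multiplicative function `n ↦ φ n * n ^ (-s)`. -/
noncomputable def twistHom (φ : ℕ →*₀ ℝ) {s : ℂ} (hs : s ≠ 0) : ℕ →*₀ ℂ where
  toFun n := φ n * (n : ℂ) ^ (-s)
  map_zero' := by simp
  map_one' := by simp
  map_mul' m n := by
    have := map_mul (riemannZetaSummandHom hs) m n
    simp only [riemannZetaSummandHom, MonoidWithZeroHom.coe_mk, ZeroHom.coe_mk] at this
    rw [this, map_mul]
    push_cast
    ring

theorem summable_norm_twistHom {φ : ℕ →*₀ ℝ} (hφ : ∀ n, |φ n| ≤ 1) {s : ℂ} (hs : 1 < s.re) :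
    Summable (fun n => ‖twistHom φ (Complex.ne_zero_of_one_lt_re hs) n‖) := by
  refine (summable_riemannZetaSummand hs).of_nonneg_of_le (fun _ => norm_nonneg _) fun n => ?_
  simp only [twistHom, riemannZetaSummandHom, MonoidWithZeroHom.coe_mk, ZeroHom.coe_mk, norm_mul,
    Complex.norm_real, Real.norm_eq_abs]
  exact mul_le_of_le_one_left (norm_nonneg _) (hφ n)

theorem tsum_twistHom (φ : ℕ →*₀ ℝ) {s : ℂ} (hs : s ≠ 0) :
    ∑' n, twistHom φ hs n = LSeries (fun n => (φ n : ℂ)) s := by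
  simp only [twistHom, Complex.cpow_neg, MonoidWithZeroHom.coe_mk, ZeroHom.coe_mk, LSeries,
    LSeries.term_of_ne_zero' hs, div_eq_mul_inv]

theorem norm_LSeries_le_zeta {φ : ℕ →*₀ ℝ} (hφ : ∀ n, |φ n| ≤ 1) {σ : ℝ} (hσ : 0 < σ) (t : ℝ) :
    ‖LSeries (fun n => (φ n : ℂ)) (1 + σ + t * Complex.I)‖
      ≤ ‖riemannZeta (1 + σ)‖ ^ ((17 : ℝ) / 24)
        * ‖riemannZeta (1 + σ + 2 * t * Complex.I)‖ ^ ((1 : ℝ) / 3) := by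
  have r1 : 1 < (1 + σ + t * Complex.I : ℂ).re := by simp [hσ]
  have r2 : 1 < (1 + σ : ℂ).re := by simp [hσ]
  have r3 : 1 < (1 + σ + 2 * t * Complex.I : ℂ).re := by simp [hσ]
  have m1 := summable_norm_twistHom hφ r1
  have m2 := summable_riemannZetaSummand r2
  have m3 := summable_riemannZetaSummand r3
  rw [← tsum_twistHom φ (Complex.ne_zero_of_one_lt_re r1), ← tsum_riemannZetaSummand r2,
    ← tsum_riemannZetaSummand r3, ← EulerProduct.exp_tsum_primes_log_eq_tsum m1,
    ← EulerProduct.exp_tsum_primes_log_eq_tsum m2, ← EulerProduct.exp_tsum_primes_log_eq_tsum m3,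
    Complex.norm_exp, Complex.norm_exp, Complex.norm_exp, ← Real.exp_mul, ← Real.exp_mul,
    ← Real.exp_add, Real.exp_le_exp]
  have q1 := Complex.hasSum_re (m1.of_norm.clog_one_sub.neg.subtype Nat.Prime).hasSum
  have q2 := Complex.hasSum_re (m2.of_norm.clog_one_sub.neg.subtype Nat.Prime).hasSum
  have q3 := Complex.hasSum_re (m3.of_norm.clog_one_sub.neg.subtype Nat.Prime).hasSum
  refine hasSum_le (fun p => ?_) q1 ((q2.mul_right _).add (q3.mul_right _))
  obtain ⟨p, hp⟩ := p
  have hp0 : (p : ℂ) ≠ 0 := by exact_mod_cast hp.ne_zero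
  have hp1 : (0 : ℝ) < p := by exact_mod_cast hp.pos
  simp only [Function.comp_apply, twistHom, riemannZetaSummandHom, MonoidWithZeroHom.coe_mk,
    ZeroHom.coe_mk]
  have hu : ‖(p : ℂ) ^ (-(t * Complex.I))‖ = 1 := by
    rw [← Complex.ofReal_natCast, Complex.norm_cpow_eq_rpow_re_of_pos hp1]
    simp
  have hr1 : (p : ℝ) ^ (-(1 + σ)) < 1 :=
    Real.rpow_lt_one_of_one_lt_of_neg (by exact_mod_cast hp.one_lt) (by linarith)
  have key := re_neg_log_one_sub_le (hφ p) (Real.rpow_nonneg hp1.le (-(1 + σ))) hr1 hu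
  have e0 : (((p : ℝ) ^ (-(1 + σ)) : ℝ) : ℂ) = (p : ℂ) ^ (-(1 + σ) : ℂ) := by
    rw [Complex.ofReal_cpow hp1.le]; push_cast; rfl
  have e1 : (p : ℂ) ^ (-(1 + σ) : ℂ) * (p : ℂ) ^ (-(t * Complex.I))
      = (p : ℂ) ^ (-(1 + σ + t * Complex.I)) := by
    rw [← Complex.cpow_add _ _ hp0]; congr 1; ring
  have e2 : (p : ℂ) ^ (-(1 + σ) : ℂ) * ((p : ℂ) ^ (-(t * Complex.I))) ^ 2
      = (p : ℂ) ^ (-(1 + σ + 2 * t * Complex.I)) := by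
    rw [pow_two, ← Complex.cpow_add _ _ hp0, ← Complex.cpow_add _ _ hp0]; congr 1; ring
  rw [e0, e1, e2] at key
  linarith

theorem sum_Icc_ite_lt (N M : ℕ) (h : N ≤ M) :
    ∑ k ∈ Finset.Icc 1 M, (if N < k then (1 : ℂ) else 0) = (M : ℂ) - N := by
  rw [← Finset.sum_filter, Finset.sum_const, nsmul_eq_mul, mul_one]
  have : (Finset.Icc 1 M).filter (fun k => N < k) = Finset.Ioc N M := by
    ext k; simp only [Finset.mem_filter, Finset.mem_Icc, Finset.mem_Ioc]; omega
  rw [this, Nat.card_Ioc, Nat.cast_sub h]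

open MeasureTheory in
theorem norm_LSeries_tail_le {s : ℂ} (hs : 1 < s.re) {N : ℕ} (hN : 1 ≤ N) :
    ‖LSeries (fun n => if N < n then (1 : ℂ) else 0) s‖ ≤ 1 / ‖s - 1‖ + ‖s‖ / N := by
  have hN0 : (0 : ℝ) < N := by exact_mod_cast hN
  have hN1 : (1 : ℝ) ≤ N := by exact_mod_cast hN
  have hs0 : s ≠ 0 := Complex.ne_zero_of_one_lt_re hs
  have hs1 : s - 1 ≠ 0 := fun h => by
    rw [sub_eq_zero.mp h] at hs; simp at hs
  rw [LSeries_eq_mul_integral' _ zero_le_one hs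
    (Asymptotics.IsBigO.of_bound 1 (Filter.Eventually.of_forall fun M => ?_))]
  · have i1 : IntegrableOn (fun u : ℝ => (u : ℂ) ^ (-s)) (Set.Ioi (N : ℝ)) :=
      integrableOn_Ioi_cpow_of_lt (by simpa using hs) hN0
    have i2 : IntegrableOn (fun u : ℝ => (u : ℂ) ^ (-(s + 1))) (Set.Ioi (N : ℝ)) :=
      integrableOn_Ioi_cpow_of_lt (by simp; linarith) hN0
    have bd : ∀ u ∈ Set.Ioi (N : ℝ),
        ‖((Int.fract u : ℝ) : ℂ) * (u : ℂ) ^ (-(s + 1))‖ ≤ u ^ (-2 : ℝ) := by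
      intro u hu
      have hu0 : 0 < u := hN0.trans hu
      rw [norm_mul, Complex.norm_cpow_eq_rpow_re_of_pos hu0, Complex.norm_real,
        Real.norm_of_nonneg (Int.fract_nonneg u)]
      calc _ ≤ 1 * u ^ (-(s + 1)).re := by gcongr; exact (Int.fract_lt_one u).le
        _ ≤ u ^ (-2 : ℝ) := by
          rw [one_mul]
          exact Real.rpow_le_rpow_of_exponent_le (hN1.trans (le_of_lt hu)) (by simp; linarith)
    have i0 : IntegrableOn (fun u : ℝ => u ^ (-2 : ℝ)) (Set.Ioi (N : ℝ)) :=
      integrableOn_Ioi_rpow_of_lt (by norm_num) hN0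
    have i3 : IntegrableOn (fun u : ℝ => ((Int.fract u : ℝ) : ℂ) * (u : ℂ) ^ (-(s + 1)))
        (Set.Ioi (N : ℝ)) := by
      refine Integrable.mono' i0 ?_ ((ae_restrict_iff' measurableSet_Ioi).mpr (ae_of_all _ bd))
      have : Measurable fun u : ℝ => ((Int.fract u : ℝ) : ℂ) :=
        Complex.measurable_ofReal.comp measurable_fract
      exact this.aestronglyMeasurable.mul i2.aestronglyMeasurable
    have e1 : ∫ u in Set.Ioi (1 : ℝ), (∑ k ∈ Finset.Icc 1 ⌊u⌋₊, if N < k then (1 : ℂ) else 0)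
          * (u : ℂ) ^ (-(s + 1))
        = ∫ u in Set.Ioi (N : ℝ), ((u : ℂ) ^ (-s) - N * (u : ℂ) ^ (-(s + 1))
          - ((Int.fract u : ℝ) : ℂ) * (u : ℂ) ^ (-(s + 1))) := by
      rw [setIntegral_eq_of_subset_of_forall_sdiff_eq_zero measurableSet_Ioi
        (Set.Ioi_subset_Ioi hN1)]
      · refine setIntegral_congr_fun measurableSet_Ioi fun u hu => ?_
        have hu0 : 0 < u := hN0.trans hu
        have huC : (u : ℂ) ≠ 0 := by exact_mod_cast hu0.ne'
        rw [sum_Icc_ite_lt _ _ (Nat.le_floor (le_of_lt hu))]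
        have h1 : (u : ℂ) ^ (-s) = u * (u : ℂ) ^ (-(s + 1)) := by
          nth_rewrite 2 [← Complex.cpow_one (u : ℂ)]
          rw [← Complex.cpow_add _ _ huC]; congr 1; ring
        have h2 : ((⌊u⌋₊ : ℕ) : ℂ) = u - Int.fract u := by
          rw [← Complex.ofReal_sub, Int.self_sub_fract, ← natCast_floor_eq_intCast_floor hu0.le]
          simp
        rw [h1, h2]; ring
      · intro u hu
        have : ⌊u⌋₊ ≤ N := by
          have : u ≤ N := by simpa using hu.2
          exact Nat.floor_le_of_le this
        rw [Finset.sum_eq_zero, zero_mul]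
        intro k hk
        rw [if_neg]
        have := (Finset.mem_Icc.mp hk).2
        omega
    have hNC : (N : ℂ) ≠ 0 := by exact_mod_cast hN0.ne'
    have e2 : s * ∫ u in Set.Ioi (N : ℝ), ((u : ℂ) ^ (-s) - N * (u : ℂ) ^ (-(s + 1)))
        = (N : ℂ) ^ (1 - s) / (s - 1) := by
      rw [integral_sub i1 (i2.const_mul _), integral_const_mul,
        integral_Ioi_cpow_of_lt (by simpa using hs) hN0,
        integral_Ioi_cpow_of_lt (by simp; linarith) hN0]
      have : (N : ℂ) ^ (-s + 1) = N * (N : ℂ) ^ (-(s + 1) + 1) := by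
        nth_rewrite 2 [← Complex.cpow_one (N : ℂ)]
        rw [← Complex.cpow_add _ _ hNC]; congr 1; ring
      simp only [Complex.ofReal_natCast]
      rw [show (1 - s) = -s + 1 by ring, this, show -(s + 1) + 1 = -s by ring]
      have h3 : -s + 1 ≠ 0 := fun h => hs1 (by linear_combination -h)
      field_simp
      ring
    have i4 : IntegrableOn (fun u : ℝ => (u : ℂ) ^ (-s) - N * (u : ℂ) ^ (-(s + 1)))
        (Set.Ioi (N : ℝ)) := i1.sub (i2.const_mul _)
    rw [e1, integral_sub i4 i3, mul_sub, e2]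
    refine (norm_sub_le _ _).trans (add_le_add ?_ ?_)
    · rw [norm_div]
      gcongr
      rw [← Complex.ofReal_natCast, Complex.norm_cpow_eq_rpow_re_of_pos hN0]
      exact Real.rpow_le_one_of_one_le_of_nonpos hN1 (by simp; linarith)
    · rw [norm_mul, div_eq_mul_inv]
      gcongr
      refine (norm_integral_le_of_norm_le i0
        ((ae_restrict_iff' measurableSet_Ioi).mpr (ae_of_all _ bd))).trans ?_
      rw [integral_Ioi_rpow_of_lt (by norm_num) hN0]
      norm_num
      rw [Real.rpow_neg_one]
  · rw [Real.norm_of_nonneg (Finset.sum_nonneg fun _ _ => norm_nonneg _), Real.rpow_one, one_mul,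
      Real.norm_of_nonneg (Nat.cast_nonneg M)]
    calc _ ≤ ∑ k ∈ Finset.Icc 1 M, (1 : ℝ) := by
          gcongr with k; split_ifs <;> simp
      _ = M := by simp

theorem norm_riemannZeta_le {s : ℂ} (hs : 1 < s.re) {N : ℕ} (hN : 1 ≤ N) :
    ‖riemannZeta s‖ ≤ ∑ n ∈ Finset.Icc 1 N, (1 : ℝ) / n + 1 / ‖s - 1‖ + ‖s‖ / N := by
  have hs0 : s ≠ 0 := Complex.ne_zero_of_one_lt_re hs
  have hsum : Summable (fun n => LSeries.term 1 s n) := LSeriesSummable_one_iff.mpr hs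
  have hsplit : riemannZeta s = ∑ n ∈ Finset.Icc 1 N, (n : ℂ) ^ (-s)
      + LSeries (fun n => if N < n then (1 : ℂ) else 0) s := by
    have h1 : LSeriesSummable (fun n => if N < n then (1 : ℂ) else 0) s := by
      refine Summable.of_norm_bounded hsum.norm fun n => ?_
      rw [LSeries.norm_term_eq, LSeries.norm_term_eq]
      split_ifs <;> simp [Real.rpow_nonneg]
    rw [← LSeries_one_eq_riemannZeta hs, LSeries, LSeries,
      ← sub_eq_iff_eq_add, ← Summable.tsum_sub hsum h1, tsum_eq_sum (s := Finset.Icc 1 N)]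
    · refine Finset.sum_congr rfl fun n hn => ?_
      have := Finset.mem_Icc.mp hn
      rw [LSeries.term_of_ne_zero (by omega), LSeries.term_of_ne_zero (by omega), if_neg (by omega),
        Complex.cpow_neg]
      simp
    · intro n hn
      rcases Nat.eq_zero_or_pos n with rfl | hn0
      · simp
      · have : N < n := by
          by_contra h
          exact hn (Finset.mem_Icc.mpr ⟨hn0, by omega⟩)
        rw [LSeries.term_of_ne_zero (by omega), LSeries.term_of_ne_zero (by omega), if_pos this]
        simp
  rw [hsplit, add_assoc]
  refine (norm_add_le _ _).trans (add_le_add ?_ (norm_LSeries_tail_le hs hN))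
  refine (norm_sum_le _ _).trans (Finset.sum_le_sum fun n hn => ?_)
  have hn1 : (1 : ℝ) ≤ n := by exact_mod_cast (Finset.mem_Icc.mp hn).1
  rw [← Complex.ofReal_natCast, Complex.norm_cpow_eq_rpow_re_of_pos (by linarith), one_div,
    ← Real.rpow_neg_one]
  exact Real.rpow_le_rpow_of_exponent_le hn1 (by simp; linarith)

theorem norm_one_sub_exp_neg_le {z : ℂ} (hz : 0 ≤ z.re) : ‖1 - Complex.exp (-z)‖ ≤ ‖z‖ := by
  have h := (convex_halfSpace_re_le (0 : ℝ)).norm_image_sub_le_of_norm_hasDerivWithin_le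
    (f := Complex.exp) (f' := Complex.exp) (C := 1) (x := -z) (y := 0)
    (fun x _ => (Complex.hasDerivAt_exp x).hasDerivWithinAt)
    (fun x hx => by rw [Complex.norm_exp]; exact Real.exp_le_one_iff.mpr hx)
    (by simpa using hz) (by simp)
  simpa using h

theorem norm_one_sub_exp_neg_le_two {z : ℂ} (hz : 0 ≤ z.re) : ‖1 - Complex.exp (-z)‖ ≤ 2 := by
  refine (norm_sub_le _ _).trans ?_
  rw [norm_one, Complex.norm_exp]
  have : Real.exp (-z).re ≤ 1 := Real.exp_le_one_iff.mpr (by simpa using hz)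
  linarith

theorem norm_riemannZeta_one_add_le {σ : ℝ} (h0 : 0 < σ) (h1 : σ ≤ 1) :
    ‖riemannZeta (1 + σ)‖ ≤ 4 / σ := by
  have h := norm_riemannZeta_le (s := 1 + σ) (by simp [h0]) le_rfl
  have e1 : ‖(1 + σ : ℂ) - 1‖ = σ := by
    rw [add_sub_cancel_left, Complex.norm_real, Real.norm_of_nonneg h0.le]
  have e2 : ‖(1 + σ : ℂ)‖ = 1 + σ := by
    rw [← Complex.ofReal_one, ← Complex.ofReal_add, Complex.norm_real,
      Real.norm_of_nonneg (by linarith)]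
  rw [e1, e2] at h
  simp only [Finset.Icc_self, Finset.sum_singleton, Nat.cast_one, div_one] at h
  refine h.trans ?_
  rw [← sub_nonneg]
  have : 4 / σ - (1 + 1 / σ + (1 + σ)) = (3 - 2 * σ - σ ^ 2) / σ := by field_simp; ring
  rw [this]
  exact div_nonneg (by nlinarith) h0.le

theorem norm_riemannZeta_le_of_abs_le_two {σ t : ℝ} (h0 : 0 < σ) (h1 : σ ≤ 1) (ht : |t| ≤ 2) :
    ‖riemannZeta (1 + σ + t * Complex.I)‖ ≤ 16 / ‖(σ + t * Complex.I : ℂ)‖ := by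
  have h := norm_riemannZeta_le (s := 1 + σ + t * Complex.I) (by simp [h0]) le_rfl
  set w : ℂ := σ + t * Complex.I with hw
  have e1 : (1 + σ + t * Complex.I : ℂ) - 1 = w := by rw [hw]; ring
  have e3 : (1 + σ + t * Complex.I : ℂ) = 1 + w := by rw [hw]; ring
  have hw3 : ‖w‖ ≤ 3 := by
    refine (norm_add_le _ _).trans ?_
    rw [norm_mul, Complex.norm_I, Complex.norm_real, Complex.norm_real, Real.norm_of_nonneg h0.le,
      Real.norm_eq_abs]
    linarith
  have hw0 : 0 < ‖w‖ := by
    refine norm_pos_iff.mpr fun h => ?_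
    have := congrArg Complex.re h
    simp [hw] at this
    linarith
  have e2 : ‖1 + w‖ ≤ 4 := (norm_add_le _ _).trans (by rw [norm_one]; linarith)
  rw [e1, e3] at h
  rw [e3]
  simp only [Finset.Icc_self, Finset.sum_singleton, Nat.cast_one, div_one] at h
  refine h.trans ?_
  calc _ ≤ 1 + 1 / ‖w‖ + 4 := by gcongr
    _ = (1 + 5 * ‖w‖) / ‖w‖ := by field_simp; ring
    _ ≤ _ := by gcongr; linarith

theorem norm_riemannZeta_le_log {σ t : ℝ} (h0 : 0 < σ) (h1 : σ ≤ 1) (ht : 1 ≤ |t|) :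
    ‖riemannZeta (1 + σ + t * Complex.I)‖ ≤ 5 + Real.log (1 + |t|) := by
  have hN : 1 ≤ ⌈|t|⌉₊ := Nat.one_le_ceil_iff.mpr (by linarith)
  have hN1 : |t| ≤ ⌈|t|⌉₊ := Nat.le_ceil _
  have hN2 : (⌈|t|⌉₊ : ℝ) ≤ 1 + |t| := by linarith [Nat.ceil_lt_add_one (abs_nonneg t)]
  have h := norm_riemannZeta_le (s := 1 + σ + t * Complex.I) (by simp [h0]) hN
  have b1 : ∑ n ∈ Finset.Icc 1 ⌈|t|⌉₊, (1 : ℝ) / n ≤ 1 + Real.log (1 + |t|) := by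
    have := harmonic_le_one_add_log ⌈|t|⌉₊
    rw [harmonic_eq_sum_Icc] at this
    push_cast at this
    simp only [one_div]
    refine this.trans ?_
    gcongr
  have b2 : 1 / ‖(1 + σ + t * Complex.I : ℂ) - 1‖ ≤ 1 := by
    rw [div_le_one₀]
    · refine ht.trans ?_
      have := Complex.abs_im_le_norm ((1 + σ + t * Complex.I : ℂ) - 1)
      simpa using this
    · refine norm_pos_iff.mpr fun h => ?_
      have := congrArg Complex.re h
      simp at this
      linarith
  have b3 : ‖(1 + σ + t * Complex.I : ℂ)‖ / ⌈|t|⌉₊ ≤ 3 := by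
    rw [div_le_iff₀ (by linarith)]
    have : ‖(1 + σ + t * Complex.I : ℂ)‖ ≤ 1 + σ + |t| := by
      refine (norm_add₃_le).trans ?_
      rw [norm_mul, Complex.norm_I, Complex.norm_real, Complex.norm_real,
        Real.norm_of_nonneg h0.le, Real.norm_eq_abs, norm_one, mul_one]
    linarith
  linarith

theorem norm_LSeries_mul_norm_one_sub_le {φ : ℕ →*₀ ℝ} (hφ : ∀ n, |φ n| ≤ 1) {σ t ℓ : ℝ}
    (h0 : 0 < σ) (h1 : σ ≤ 1) (hℓ : 0 ≤ ℓ) (ht : |t| ≤ σ ^ (-4 : ℝ)) :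
    ‖LSeries (fun n => (φ n : ℂ)) (1 + σ + t * Complex.I)‖
        * ‖1 - Complex.exp (-((σ + t * Complex.I) * ℓ))‖
      ≤ 32 * (1 + ℓ) * σ ^ (-(3 / 4) : ℝ) := by
  set w : ℂ := σ + t * Complex.I with hw
  have hwre : w.re = σ := by simp [hw]
  have hwim : w.im = t := by simp [hw]
  have hzre : 0 ≤ (w * ℓ).re := by
    rw [mul_comm, Complex.re_ofReal_mul, hwre]; positivity
  have hw0 : 0 < ‖w‖ := by
    refine norm_pos_iff.mpr fun h => ?_
    rw [h] at hwre
    simp at hwre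
    linarith
  have hF := norm_LSeries_le_zeta hφ h0 t
  have z1 : ‖riemannZeta (1 + σ)‖ ^ ((17 : ℝ) / 24) ≤ 4 * σ ^ (-(17 / 24) : ℝ) := by
    calc _ ≤ (4 / σ) ^ ((17 : ℝ) / 24) := by gcongr; exact norm_riemannZeta_one_add_le h0 h1
      _ = 4 ^ ((17 : ℝ) / 24) * σ ^ (-(17 / 24) : ℝ) := by
        rw [Real.div_rpow (by norm_num) h0.le, Real.rpow_neg h0.le, div_eq_mul_inv]
      _ ≤ 4 ^ (1 : ℝ) * σ ^ (-(17 / 24) : ℝ) := by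
        gcongr <;> norm_num
      _ = _ := by rw [Real.rpow_one]
  rcases le_total |t| 1 with h | h
  · have z2 : ‖riemannZeta (1 + σ + 2 * t * Complex.I)‖ ^ ((1 : ℝ) / 3)
        ≤ 3 * ‖w‖ ^ (-(1 / 3) : ℝ) := by
      have e : (1 + σ + 2 * t * Complex.I : ℂ) = 1 + σ + ((2 * t : ℝ) : ℂ) * Complex.I := by
        push_cast; ring
      have b := norm_riemannZeta_le_of_abs_le_two h0 h1 (t := 2 * t)
        (by rw [abs_mul, abs_two]; linarith)
      have hww : ‖w‖ ≤ ‖(σ + ((2 * t : ℝ) : ℂ) * Complex.I : ℂ)‖ := by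
        rw [Complex.norm_def, Complex.norm_def]
        apply Real.sqrt_le_sqrt
        rw [Complex.normSq_apply, Complex.normSq_apply, hwre, hwim]
        simp
        nlinarith [mul_self_nonneg t]
      rw [e]
      calc _ ≤ (27 / ‖w‖) ^ ((1 : ℝ) / 3) := by
            gcongr
            refine b.trans ?_
            gcongr
            norm_num
        _ = 27 ^ ((1 : ℝ) / 3) * ‖w‖ ^ (-(1 / 3) : ℝ) := by
          rw [Real.div_rpow (by norm_num) hw0.le, Real.rpow_neg hw0.le, div_eq_mul_inv]
        _ = _ := by
          rw [show (27 : ℝ) = 3 ^ (3 : ℝ) by norm_num, ← Real.rpow_mul (by norm_num)]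
          norm_num
    have z3 : ‖1 - Complex.exp (-(w * ℓ))‖ ≤ ‖w‖ * ℓ := by
      refine (norm_one_sub_exp_neg_le hzre).trans ?_
      rw [norm_mul, Complex.norm_real, Real.norm_of_nonneg hℓ]
    have hw2 : ‖w‖ ≤ 2 := by
      refine (norm_add_le _ _).trans ?_
      rw [norm_mul, Complex.norm_I, Complex.norm_real, Complex.norm_real,
        Real.norm_of_nonneg h0.le, Real.norm_eq_abs]
      linarith
    have z4 : ‖w‖ ^ (-(1 / 3) : ℝ) * ‖w‖ ≤ 2 := by
      nth_rewrite 2 [← Real.rpow_one ‖w‖]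
      rw [← Real.rpow_add hw0]
      calc _ ≤ (2 : ℝ) ^ (-(1 / 3) + 1 : ℝ) := by gcongr
        _ ≤ (2 : ℝ) ^ (1 : ℝ) := by gcongr <;> norm_num
        _ = 2 := by norm_num
    have z5 : σ ^ (-(17 / 24) : ℝ) ≤ σ ^ (-(3 / 4) : ℝ) :=
      Real.rpow_le_rpow_of_exponent_ge h0 h1 (by norm_num)
    calc _ ≤ ((4 * σ ^ (-(17 / 24) : ℝ)) * (3 * ‖w‖ ^ (-(1 / 3) : ℝ))) * (‖w‖ * ℓ) := by
          gcongr
          exact hF.trans (by gcongr)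
      _ = 12 * σ ^ (-(17 / 24) : ℝ) * (‖w‖ ^ (-(1 / 3) : ℝ) * ‖w‖) * ℓ := by ring
      _ ≤ 12 * σ ^ (-(3 / 4) : ℝ) * 2 * ℓ := by gcongr
      _ ≤ _ := by
        have : 0 < σ ^ (-(3 / 4) : ℝ) := by positivity
        nlinarith
  · have z2 : ‖riemannZeta (1 + σ + 2 * t * Complex.I)‖ ^ ((1 : ℝ) / 3)
        ≤ 4 * σ ^ (-(1 / 24) : ℝ) := by
      have e : (1 + σ + 2 * t * Complex.I : ℂ) = 1 + σ + ((2 * t : ℝ) : ℂ) * Complex.I := by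
        push_cast; ring
      have b := norm_riemannZeta_le_log h0 h1 (t := 2 * t) (by rw [abs_mul, abs_two]; linarith)
      have hσ4 : 1 ≤ σ ^ (-4 : ℝ) := Real.one_le_rpow_of_pos_of_le_one_of_nonpos h0 h1 (by norm_num)
      have hσ8 : 1 ≤ σ ^ (-(1 / 8) : ℝ) :=
        Real.one_le_rpow_of_pos_of_le_one_of_nonpos h0 h1 (by norm_num)
      have l1 : Real.log (1 + |2 * t|) ≤ 2 + 32 * σ ^ (-(1 / 8) : ℝ) := by
        calc _ ≤ Real.log (3 * σ ^ (-4 : ℝ)) := by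
              apply Real.log_le_log (by positivity)
              rw [abs_mul, abs_two]; linarith
          _ = Real.log 3 + Real.log (σ ^ (-4 : ℝ)) := Real.log_mul (by norm_num) (by positivity)
          _ ≤ 2 + (σ ^ (-4 : ℝ)) ^ (1 / 32 : ℝ) / (1 / 32) := by
              gcongr
              · linarith [Real.log_le_sub_one_of_pos (show (0 : ℝ) < 3 by norm_num)]
              · exact Real.log_le_rpow_div (by positivity) (by norm_num)
          _ = _ := by
              rw [← Real.rpow_mul h0.le]
              norm_num
              ring
      rw [e]
      calc _ ≤ (64 * σ ^ (-(1 / 8) : ℝ)) ^ ((1 : ℝ) / 3) := by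
            gcongr
            linarith
        _ = 64 ^ ((1 : ℝ) / 3) * σ ^ (-(1 / 24) : ℝ) := by
          rw [Real.mul_rpow (by norm_num) (by positivity), ← Real.rpow_mul h0.le]
          norm_num
        _ = _ := by
          rw [show (64 : ℝ) = 4 ^ (3 : ℝ) by norm_num, ← Real.rpow_mul (by norm_num)]
          norm_num
    calc _ ≤ ((4 * σ ^ (-(17 / 24) : ℝ)) * (4 * σ ^ (-(1 / 24) : ℝ))) * 2 := by
          gcongr
          · exact hF.trans (by gcongr)
          · exact norm_one_sub_exp_neg_le_two hzre
      _ = 32 * (σ ^ (-(17 / 24) : ℝ) * σ ^ (-(1 / 24) : ℝ)) := by ring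
      _ = 32 * σ ^ (-(3 / 4) : ℝ) := by rw [← Real.rpow_add h0]; norm_num
      _ ≤ _ := by
        have : 0 < σ ^ (-(3 / 4) : ℝ) := by positivity
        nlinarith

theorem convolution_mul_vonMangoldt (φ : ℕ →*₀ ℝ) :
    LSeries.convolution (fun n => (φ n : ℂ))
      (fun n => ((φ n * ArithmeticFunction.vonMangoldt n : ℝ) : ℂ))
      = fun n => ((φ n * Real.log n : ℝ) : ℂ) := by
  rw [LSeries.convolution_def]
  funext n
  rw [← ArithmeticFunction.vonMangoldt_sum, ← Nat.sum_divisorsAntidiagonal'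
    (f := fun _ b => ArithmeticFunction.vonMangoldt b), Finset.mul_sum]
  push_cast
  refine Finset.sum_congr rfl fun p hp => ?_
  rw [← (Nat.mem_divisorsAntidiagonal.mp hp).1, map_mul]
  push_cast
  ring

theorem sum_norm_mul_vonMangoldt_le {φ : ℕ →*₀ ℝ} (hφ : ∀ n, |φ n| ≤ 1) {σ : ℝ} (hσ : 0 < σ)
    (N : ℕ) :
    ∑ n ∈ Finset.Icc 1 N, ‖((φ n * ArithmeticFunction.vonMangoldt n : ℝ) : ℂ)‖
      ≤ 6 * (N : ℝ) ^ (1 + σ / 2) := by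
  rcases Nat.eq_zero_or_pos N with rfl | hN
  · simp; positivity
  have hN1 : (1 : ℝ) ≤ N := by exact_mod_cast hN
  have hpsi := Chebyshev.psi_le_const_mul_self (x := N) (by positivity)
  have hlog : Real.log 4 + 4 ≤ 6 := by
    rw [show (4 : ℝ) = 2 ^ 2 by norm_num, Real.log_pow]
    push_cast
    linarith [Real.log_two_lt_d9]
  calc _ ≤ ∑ n ∈ Finset.Icc 0 N, ArithmeticFunction.vonMangoldt n := by
        refine (Finset.sum_le_sum fun n _ => ?_).trans (Finset.sum_le_sum_of_subset_of_nonneg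
          (Finset.Icc_subset_Icc_left zero_le_one)
          fun _ _ _ => ArithmeticFunction.vonMangoldt_nonneg)
        rw [Complex.norm_real, Real.norm_eq_abs, abs_mul,
          abs_of_nonneg ArithmeticFunction.vonMangoldt_nonneg]
        exact mul_le_of_le_one_left ArithmeticFunction.vonMangoldt_nonneg (hφ n)
    _ = Chebyshev.psi N := by rw [Chebyshev.psi_eq_sum_Icc, Nat.floor_natCast]
    _ ≤ 6 * N := hpsi.trans (by gcongr)
    _ ≤ _ := by
      gcongr
      nth_rewrite 1 [← Real.rpow_one (N : ℝ)]
      exact Real.rpow_le_rpow_of_exponent_le hN1 (by linarith)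

theorem log_natCast_le {σ : ℝ} (hσ : 0 < σ) (n : ℕ) :
    Real.log n ≤ 2 / σ * (n : ℝ) ^ (σ / 2) := by
  refine (Real.log_le_rpow_div (Nat.cast_nonneg n) (half_pos hσ)).trans (le_of_eq ?_)
  field_simp

theorem sum_norm_mul_log_le {φ : ℕ →*₀ ℝ} (hφ : ∀ n, |φ n| ≤ 1) {σ : ℝ} (hσ : 0 < σ) (N : ℕ) :
    ∑ n ∈ Finset.Icc 1 N, ‖((φ n * Real.log n : ℝ) : ℂ)‖ ≤ 2 / σ * (N : ℝ) ^ (1 + σ / 2) := by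
  calc _ ≤ ∑ n ∈ Finset.Icc 1 N, Real.log N := by
        refine Finset.sum_le_sum fun n hn => ?_
        have hn1 : (1 : ℝ) ≤ n := by exact_mod_cast (Finset.mem_Icc.mp hn).1
        rw [Complex.norm_real, Real.norm_eq_abs, abs_mul, abs_of_nonneg (Real.log_nonneg hn1)]
        refine (mul_le_of_le_one_left (Real.log_nonneg hn1) (hφ n)).trans ?_
        gcongr
        exact (Finset.mem_Icc.mp hn).2
    _ = N * Real.log N := by simp
    _ ≤ N * (2 / σ * (N : ℝ) ^ (σ / 2)) := by gcongr; exact log_natCast_le hσ N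
    _ = _ := by
      rcases Nat.eq_zero_or_pos N with rfl | hN
      · simp [(show (1 + σ / 2) ≠ 0 by positivity)]
      · rw [Real.rpow_add (by exact_mod_cast hN), Real.rpow_one]; ring

theorem norm_LSeries_mul_log_le {φ : ℕ →*₀ ℝ} (hφ : ∀ n, |φ n| ≤ 1) {σ : ℝ} (h0 : 0 < σ)
    (h1 : σ ≤ 1) (t : ℝ) :
    ‖LSeries (fun n => ((φ n * Real.log n : ℝ) : ℂ)) (1 + σ + t * Complex.I)‖
      ≤ 16 * σ ^ (-2 : ℝ) := by
  have hre : (1 + σ + t * Complex.I : ℂ).re = 1 + σ := by simp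
  have hsum : Summable fun n : ℕ => 1 / (n : ℝ) ^ (1 + σ / 2) :=
    Real.summable_one_div_nat_rpow.mpr (by linarith)
  have hz : ∑' n : ℕ, 1 / (n : ℝ) ^ (1 + σ / 2) ≤ 8 / σ := by
    have e := zeta_eq_tsum_one_div_nat_cpow (s := 1 + (σ / 2 : ℝ)) (by simp [h0])
    have e2 : ∑' n : ℕ, 1 / (n : ℂ) ^ (1 + ((σ / 2 : ℝ) : ℂ))
        = ((∑' n : ℕ, 1 / (n : ℝ) ^ (1 + σ / 2) : ℝ) : ℂ) := by
      rw [Complex.ofReal_tsum]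
      refine tsum_congr fun n => ?_
      rw [Complex.ofReal_div (1 : ℝ), Complex.ofReal_cpow (Nat.cast_nonneg n)]
      push_cast
      rfl
    have b := norm_riemannZeta_one_add_le (half_pos h0) (by linarith)
    rw [e, e2, Complex.norm_real] at b
    refine (Real.le_norm_self _).trans (b.trans (le_of_eq ?_))
    field_simp
    norm_num
  have hterm : ∀ n : ℕ, ‖LSeries.term (fun n => ((φ n * Real.log n : ℝ) : ℂ))
      (1 + σ + t * Complex.I) n‖ ≤ 2 / σ * (1 / (n : ℝ) ^ (1 + σ / 2)) := by
    intro n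
    rw [LSeries.norm_term_eq, hre]
    split_ifs with hn
    · positivity
    · have hn0 : 0 < (n : ℝ) := by exact_mod_cast Nat.pos_of_ne_zero hn
      have hn1 : (1 : ℝ) ≤ n := by exact_mod_cast Nat.pos_of_ne_zero hn
      rw [Complex.norm_real, Real.norm_eq_abs, abs_mul, abs_of_nonneg (Real.log_nonneg hn1),
        div_le_iff₀ (by positivity)]
      calc _ ≤ Real.log n := mul_le_of_le_one_left (Real.log_nonneg hn1) (hφ n)
        _ ≤ 2 / σ * (n : ℝ) ^ (σ / 2) := log_natCast_le h0 n
        _ = _ := by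
          have : (n : ℝ) ^ (1 + σ) = (n : ℝ) ^ (1 + σ / 2) * (n : ℝ) ^ (σ / 2) := by
            rw [← Real.rpow_add hn0]; ring_nf
          rw [this, mul_assoc, one_div, inv_mul_cancel_left₀ (by positivity)]
  refine (tsum_of_norm_bounded (hsum.mul_left (2 / σ)).hasSum hterm).trans ?_
  rw [tsum_mul_left, Real.rpow_neg h0.le]
  calc _ ≤ 2 / σ * (8 / σ) := by gcongr
    _ = _ := by norm_num; field_simp; norm_num

theorem LSeries_mul_log_eq {φ : ℕ →*₀ ℝ} (hφ : ∀ n, |φ n| ≤ 1) {s : ℂ} (hs : 1 < s.re) :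
    LSeries (fun n => ((φ n * Real.log n : ℝ) : ℂ)) s = LSeries (fun n => (φ n : ℂ)) s
      * LSeries (fun n => ((φ n * ArithmeticFunction.vonMangoldt n : ℝ) : ℂ)) s := by
  rw [← convolution_mul_vonMangoldt]
  refine LSeries_convolution' ?_ ?_
  · refine LSeriesSummable_of_bounded_of_one_lt_re (m := 1) (fun n _ => ?_) hs
    rw [Complex.norm_real]
    exact hφ n
  · refine Summable.of_norm_bounded (ArithmeticFunction.LSeriesSummable_vonMangoldt hs).norm
      fun n => ?_
    rw [LSeries.norm_term_eq, LSeries.norm_term_eq]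
    split_ifs
    · exact le_rfl
    · gcongr
      rw [Complex.norm_real, Complex.norm_real, norm_mul]
      exact mul_le_of_le_one_left (norm_nonneg _) (hφ n)

/-- The summatory function `∑_{n ≤ x} a n`. -/
noncomputable def summatory (a : ℕ → ℝ) (x : ℝ) : ℝ := ∑ n ∈ Finset.Icc 1 ⌊x⌋₊, a n

/-- The difference `∑_{n ≤ x} a n - α * ∑_{n ≤ x / α} a n`. -/
noncomputable def lipDiff (a : ℕ → ℝ) (α x : ℝ) : ℝ := summatory a x - α * summatory a (x / α)

theorem expMean_sub_expMean_eq (a : ℕ → ℝ) {α : ℝ} (hα : 0 < α) (σ y : ℝ) :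
    expMean (fun n => (a n : ℂ)) (1 + σ) y
        - Real.exp (-σ * Real.log α) * expMean (fun n => (a n : ℂ)) (1 + σ) (y - Real.log α)
      = ((lipDiff a α (Real.exp y) * Real.exp (-(1 + σ) * y) : ℝ) : ℂ) := by
  have e1 : Real.exp (-(1 + σ) * (y - Real.log α))
      = Real.exp (-(1 + σ) * y) * (α * Real.exp (σ * Real.log α)) := by
    nth_rewrite 2 [← Real.exp_log hα]
    rw [← Real.exp_add, ← Real.exp_add]; ring_nf
  have e2 : Real.exp (-σ * Real.log α) * Real.exp (σ * Real.log α) = 1 := by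
    rw [← Real.exp_add]; simp
  unfold expMean lipDiff summatory
  rw [e1, Real.exp_sub, Real.exp_log hα]
  have e3 : (Real.exp (-σ * Real.log α) : ℂ) * (Real.exp (σ * Real.log α) : ℂ) = 1 := by
    exact_mod_cast e2
  simp only [Complex.ofReal_mul, Complex.ofReal_sub, Complex.ofReal_sum]
  linear_combination (-(∑ n ∈ Finset.Icc 1 ⌊Real.exp y / α⌋₊, (a n : ℂ))
    * (Real.exp (-(1 + σ) * y) : ℂ) * α) * e3

open MeasureTheory FourierTransform in
theorem fourier_comp_sub_right (f : ℝ → ℂ) (ℓ ξ : ℝ) :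
    𝓕 (fun y => f (y - ℓ)) ξ = Complex.exp (-(2 * Real.pi * ξ * Complex.I * ℓ)) * 𝓕 f ξ := by
  rw [Real.fourier_real_eq_integral_exp_smul, Real.fourier_real_eq_integral_exp_smul,
    ← integral_const_mul,
    ← integral_sub_right_eq_self (fun y => Complex.exp (-(2 * Real.pi * ξ * Complex.I * ℓ))
      * (Complex.exp (((-2 * Real.pi * y * ξ : ℝ) : ℂ) * Complex.I) • f y)) ℓ]
  congr 1
  funext y
  rw [smul_eq_mul, smul_eq_mul, ← mul_assoc, ← Complex.exp_add]
  congr 2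
  push_cast
  ring

open MeasureTheory FourierTransform in
theorem fourier_sub_mul_comp_sub {f : ℝ → ℂ} (hf : Integrable f) (σ ℓ ξ : ℝ) :
    𝓕 (fun y => f y - Real.exp (-σ * ℓ) * f (y - ℓ)) ξ
      = (1 - Complex.exp (-((σ + (2 * Real.pi * ξ : ℝ) * Complex.I) * ℓ))) * 𝓕 f ξ := by
  have h1 : 𝓕 (fun y => f y - Real.exp (-σ * ℓ) * f (y - ℓ)) ξ
      = 𝓕 f ξ - Real.exp (-σ * ℓ) * 𝓕 (fun y => f (y - ℓ)) ξ := by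
    simp only [Real.fourier_eq]
    rw [← integral_const_mul, ← integral_sub]
    · congr 1
      funext y
      rw [smul_sub, Circle.smul_def, Circle.smul_def, Circle.smul_def]
      simp only [smul_eq_mul]
      ring
    · exact (Real.fourierIntegral_convergent_iff ξ).mpr hf
    · exact ((Real.fourierIntegral_convergent_iff ξ).mpr (hf.comp_sub_right ℓ)).const_mul _
  rw [h1, fourier_comp_sub_right, ← mul_assoc, Complex.ofReal_exp, ← Complex.exp_add, sub_mul,
    one_mul]
  congr 3
  push_cast
  ring_nf

open MeasureTheory in
theorem integral_two_div_sq_add_sq {T : ℝ} (hT : 0 < T) :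
    Integrable (fun ξ : ℝ => 2 / T ^ 2 * (1 + (2 * Real.pi / T * ξ) ^ 2)⁻¹) ∧
    ∫ ξ : ℝ, 2 / T ^ 2 * (1 + (2 * Real.pi / T * ξ) ^ 2)⁻¹ = 1 / T := by
  have hp : 0 < 2 * Real.pi / T := by have := Real.pi_pos; positivity
  refine ⟨(integrable_inv_one_add_sq.comp_mul_left' hp.ne').const_mul _, ?_⟩
  rw [integral_const_mul, Measure.integral_comp_mul_left (fun x : ℝ => (1 + x ^ 2)⁻¹),
    integral_univ_inv_one_add_sq, abs_of_pos (inv_pos.mpr hp), smul_eq_mul]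
  have := Real.pi_pos
  field_simp

open MeasureTheory FourierTransform in
theorem integral_sq_lipDiff_mul_log_le {φ : ℕ →*₀ ℝ} (hφ : ∀ n, |φ n| ≤ 1) {σ α : ℝ} (h0 : 0 < σ)
    (h1 : σ ≤ 1) (hα : 1 ≤ α) :
    Integrable (fun y => (lipDiff (fun n => φ n * Real.log n) α (Real.exp y)
        * Real.exp (-(1 + σ) * y)) ^ 2) ∧
    ∫ y, (lipDiff (fun n => φ n * Real.log n) α (Real.exp y) * Real.exp (-(1 + σ) * y)) ^ 2
      ≤ 40000 * (1 + Real.log α) ^ 2 * σ ^ (-(5 / 2) : ℝ) := by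
  set ℓ := Real.log α with hℓ
  have hℓ0 : 0 ≤ ℓ := Real.log_nonneg hα
  have hV := sum_norm_mul_vonMangoldt_le hφ h0
  have hH := sum_norm_mul_log_le hφ h0
  set v : ℝ → ℂ := expMean (fun n => ((φ n * ArithmeticFunction.vonMangoldt n : ℝ) : ℂ)) (1 + σ)
    with hv
  set h : ℝ → ℂ := expMean (fun n => ((φ n * Real.log n : ℝ) : ℂ)) (1 + σ) with hh
  set g : ℝ → ℂ := fun y => h y - Real.exp (-σ * ℓ) * h (y - ℓ) with hg
  have hint : Integrable h := integrable_expMean hH h0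
  have hmem : MemLp h 2 := memLp_expMean hH h0
  have vint : Integrable v := integrable_expMean hV h0
  have vmem : MemLp v 2 := memLp_expMean hV h0
  have gint : Integrable g := hint.sub ((hint.comp_sub_right ℓ).const_mul _)
  have gmem : MemLp g 2 := hmem.sub
    ((hmem.comp_measurePreserving (measurePreserving_sub_right volume ℓ)).const_mul _)
  have gnorm : ∀ y, (lipDiff (fun n => φ n * Real.log n) α (Real.exp y)
      * Real.exp (-(1 + σ) * y)) ^ 2 = ‖g y‖ ^ 2 := by
    intro y
    have := expMean_sub_expMean_eq (fun n => φ n * Real.log n) (by linarith : 0 < α) σ y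
    rw [hg, hh]
    simp only
    rw [this, Complex.norm_real, Real.norm_eq_abs, sq_abs]
  simp only [gnorm]
  refine ⟨gmem.integrable_norm_pow (by norm_num), ?_⟩
  rw [← integral_norm_sq_fourier gint gmem]
  set T : ℝ := σ ^ (-4 : ℝ) with hT
  have hT0 : 0 < T := by positivity
  obtain ⟨kint, keq⟩ := integral_two_div_sq_add_sq hT0
  have vfint : Integrable (fun ξ => ‖𝓕 v ξ‖ ^ 2) :=
    (memLp_fourier vint vmem).integrable_norm_pow (by norm_num)
  have vbound : ∫ ξ, ‖𝓕 v ξ‖ ^ 2 ≤ 36 / σ := by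
    rw [integral_norm_sq_fourier vint vmem]
    refine (integral_norm_sq_expMean_le hV h0).trans (le_of_eq (by norm_num))
  have pointwise : ∀ ξ, ‖𝓕 g ξ‖ ^ 2 ≤ 1024 * (1 + ℓ) ^ 2 * σ ^ (-(3 / 2) : ℝ) * ‖𝓕 v ξ‖ ^ 2
      + 1024 * σ ^ (-4 : ℝ) * (2 / T ^ 2 * (1 + (2 * Real.pi / T * ξ) ^ 2)⁻¹) := by
    intro ξ
    set t : ℝ := 2 * Real.pi * ξ with ht
    set s : ℂ := 1 + σ + t * Complex.I with hs
    have hs' : (1 + σ + 2 * Real.pi * ξ * Complex.I : ℂ) = s := by rw [hs, ht]; push_cast; rfl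
    have hsre : 1 < s.re := by simp [hs, h0]
    have hs0 : s ≠ 0 := Complex.ne_zero_of_one_lt_re hsre
    have f1 := fourier_expMean hH h0 ξ
    have f2 := fourier_expMean hV h0 ξ
    rw [hs'] at f1 f2
    have f3 := LSeries_mul_log_eq hφ hsre
    have f4 : 𝓕 h ξ = LSeries (fun n => (φ n : ℂ)) s * 𝓕 v ξ := by
      apply mul_left_cancel₀ hs0
      rw [f1, f3, ← f2]; ring
    have f5 : ‖𝓕 g ξ‖ = ‖1 - Complex.exp (-((σ + t * Complex.I) * ℓ))‖ * ‖𝓕 h ξ‖ := by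
      rw [hg, fourier_sub_mul_comp_sub hint, norm_mul]
    have hk0 : 0 ≤ 1024 * σ ^ (-4 : ℝ) * (2 / T ^ 2 * (1 + (2 * Real.pi / T * ξ) ^ 2)⁻¹) := by
      positivity
    rcases le_or_gt |t| T with hcase | hcase
    · have b := norm_LSeries_mul_norm_one_sub_le hφ h0 h1 hℓ0 hcase
      have e : (σ ^ (-(3 / 4) : ℝ)) ^ 2 = σ ^ (-(3 / 2) : ℝ) := by
        rw [← Real.rpow_natCast, ← Real.rpow_mul h0.le]; norm_num
      have : ‖𝓕 g ξ‖ ≤ 32 * (1 + ℓ) * σ ^ (-(3 / 4) : ℝ) * ‖𝓕 v ξ‖ := by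
        rw [f5, f4, norm_mul]
        refine le_trans (le_of_eq ?_) (mul_le_mul_of_nonneg_right b (norm_nonneg (𝓕 v ξ)))
        ring
      calc _ ≤ (32 * (1 + ℓ) * σ ^ (-(3 / 4) : ℝ) * ‖𝓕 v ξ‖) ^ 2 := by gcongr
        _ = 1024 * (1 + ℓ) ^ 2 * (σ ^ (-(3 / 4) : ℝ)) ^ 2 * ‖𝓕 v ξ‖ ^ 2 := by ring
        _ ≤ _ := by rw [e]; linarith
    · have ht0 : 0 < |t| := hT0.trans hcase
      have b1 := norm_LSeries_mul_log_le hφ h0 h1 t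
      have b2 : |t| ≤ ‖s‖ := by
        have := Complex.abs_im_le_norm s
        simpa [hs] using this
      have b3 : |t| * ‖𝓕 h ξ‖ ≤ 16 * σ ^ (-2 : ℝ) := by
        refine le_trans ?_ b1
        rw [← hs, ← f1, norm_mul]
        gcongr
      have hzre : 0 ≤ ((σ + t * Complex.I) * ℓ : ℂ).re := by
        rw [mul_comm, Complex.re_ofReal_mul]; simp; positivity
      have b4 : |t| * ‖𝓕 g ξ‖ ≤ 32 * σ ^ (-2 : ℝ) := by
        rw [f5]
        have := norm_one_sub_exp_neg_le_two hzre
        calc _ = ‖1 - Complex.exp (-((σ + t * Complex.I) * ℓ))‖ * (|t| * ‖𝓕 h ξ‖) := by ring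
          _ ≤ 2 * (16 * σ ^ (-2 : ℝ)) := by gcongr
          _ = _ := by ring
      have e : (σ ^ (-2 : ℝ)) ^ 2 = σ ^ (-4 : ℝ) := by
        rw [← Real.rpow_natCast, ← Real.rpow_mul h0.le]; norm_num
      have b5 : t ^ 2 * ‖𝓕 g ξ‖ ^ 2 ≤ 1024 * σ ^ (-4 : ℝ) := by
        calc _ = (|t| * ‖𝓕 g ξ‖) ^ 2 := by rw [mul_pow |t| ‖𝓕 g ξ‖ 2, sq_abs]
          _ ≤ (32 * σ ^ (-2 : ℝ)) ^ 2 := by gcongr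
          _ = _ := by rw [mul_pow, e]; norm_num
      have b6 : 2 / T ^ 2 * (1 + (2 * Real.pi / T * ξ) ^ 2)⁻¹ = 2 / (T ^ 2 + t ^ 2) := by
        rw [ht]; field_simp
      have b7 : T ^ 2 + t ^ 2 ≤ 2 * t ^ 2 := by
        have : T ^ 2 ≤ |t| ^ 2 := by gcongr
        rw [sq_abs] at this; linarith
      have ht2 : 0 < t ^ 2 := by rw [← sq_abs]; positivity
      have b8 : 1 / t ^ 2 ≤ 2 / (T ^ 2 + t ^ 2) := by
        rw [div_le_div_iff₀ ht2 (by positivity)]; linarith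
      have b9 : ‖𝓕 g ξ‖ ^ 2 ≤ 1024 * σ ^ (-4 : ℝ) * (1 / t ^ 2) := by
        rw [mul_one_div, le_div_iff₀ ht2, mul_comm]; exact b5
      have b10 : 0 ≤ 1024 * (1 + ℓ) ^ 2 * σ ^ (-(3 / 2) : ℝ) * ‖𝓕 v ξ‖ ^ 2 := by positivity
      rw [b6]
      have : 1024 * σ ^ (-4 : ℝ) * (1 / t ^ 2) ≤ 1024 * σ ^ (-4 : ℝ) * (2 / (T ^ 2 + t ^ 2)) := by
        gcongr
      linarith
  have gfint : Integrable (fun ξ => ‖𝓕 g ξ‖ ^ 2) :=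
    (memLp_fourier gint gmem).integrable_norm_pow (by norm_num)
  have hσ32 : σ ^ (-(3 / 2) : ℝ) / σ = σ ^ (-(5 / 2) : ℝ) := by
    nth_rewrite 2 [← Real.rpow_one σ]
    rw [← Real.rpow_sub h0]; norm_num
  have hσ52 : 1 ≤ σ ^ (-(5 / 2) : ℝ) :=
    Real.one_le_rpow_of_pos_of_le_one_of_nonpos h0 h1 (by norm_num)
  calc _ ≤ ∫ ξ, (1024 * (1 + ℓ) ^ 2 * σ ^ (-(3 / 2) : ℝ) * ‖𝓕 v ξ‖ ^ 2
      + 1024 * σ ^ (-4 : ℝ) * (2 / T ^ 2 * (1 + (2 * Real.pi / T * ξ) ^ 2)⁻¹)) :=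
        integral_mono gfint ((vfint.const_mul _).add (kint.const_mul _)) pointwise
    _ = 1024 * (1 + ℓ) ^ 2 * σ ^ (-(3 / 2) : ℝ) * (∫ ξ, ‖𝓕 v ξ‖ ^ 2)
        + 1024 * σ ^ (-4 : ℝ) * (1 / T) := by
        rw [integral_add (vfint.const_mul _) (kint.const_mul _), integral_const_mul,
          integral_const_mul, keq]
    _ ≤ 1024 * (1 + ℓ) ^ 2 * σ ^ (-(3 / 2) : ℝ) * (36 / σ) + 1024 := by
        have hTT : 1024 * σ ^ (-4 : ℝ) * (1 / T) = 1024 := by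
          rw [← hT]; field_simp
        rw [hTT]
        gcongr
    _ = 36864 * (1 + ℓ) ^ 2 * σ ^ (-(5 / 2) : ℝ) + 1024 := by
        rw [← hσ32]; ring
    _ ≤ _ := by
        have : 1 ≤ (1 + ℓ) ^ 2 * σ ^ (-(5 / 2) : ℝ) := by
          nlinarith [one_le_pow₀ (show 1 ≤ 1 + ℓ by linarith) (n := 2)]
        nlinarith

theorem sum_log_Icc_eq_log_factorial (N : ℕ) :
    ∑ n ∈ Finset.Icc 1 N, Real.log n = Real.log N.factorial := by
  induction N with
  | zero => simp
  | succ N ih =>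
    rw [Finset.sum_Icc_succ_top (by omega), ih, Nat.factorial_succ, Nat.cast_mul,
      Real.log_mul (by positivity) (by positivity), add_comm]

theorem sum_log_div_natCast_le {x : ℝ} (hx : 0 ≤ x) :
    ∑ n ∈ Finset.Icc 1 ⌊x⌋₊, (Real.log x - Real.log n) ≤ x := by
  rcases hx.eq_or_lt with rfl | hx
  · simp
  rw [Finset.sum_sub_distrib, Finset.sum_const, Nat.card_Icc, Nat.add_sub_cancel, nsmul_eq_mul]
  have h2 := Real.pow_div_factorial_le_exp x hx.le ⌊x⌋₊
  have hf : (0 : ℝ) < (⌊x⌋₊.factorial : ℝ) := by positivity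
  have h3 := Real.log_le_log (by positivity) h2
  rw [Real.log_exp, Real.log_div (by positivity) hf.ne', Real.log_pow] at h3
  rw [sum_log_Icc_eq_log_factorial]; exact h3

theorem natCast_le_of_mem_Icc_floor {x : ℝ} {n : ℕ} (hn : n ∈ Finset.Icc 1 ⌊x⌋₊) :
    1 ≤ (n : ℝ) ∧ (n : ℝ) ≤ x := by
  obtain ⟨h1, h2⟩ := Finset.mem_Icc.mp hn
  exact ⟨by exact_mod_cast h1, (Nat.le_floor_iff' (by omega)).mp h2⟩

theorem summatory_of_lt_one (a : ℕ → ℝ) {x : ℝ} (hx : x < 1) : summatory a x = 0 := by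
  simp [summatory, Nat.floor_eq_zero.mpr hx]

theorem abs_summatory_le {a : ℕ → ℝ} (ha : ∀ n, |a n| ≤ 1) {x : ℝ} (hx : 0 ≤ x) :
    |summatory a x| ≤ x := by
  refine (Finset.abs_sum_le_sum_abs _ _).trans
    ((Finset.sum_le_card_nsmul _ _ 1 fun n _ => ha n).trans ?_)
  simpa using Nat.floor_le hx

theorem measurable_summatory (a : ℕ → ℝ) : Measurable (summatory a) :=
  (measurable_from_nat (f := fun N : ℕ => ∑ n ∈ Finset.Icc 1 N, a n)).comp Nat.measurable_floor

theorem measurable_lipDiff (a : ℕ → ℝ) (α : ℝ) : Measurable (lipDiff a α) :=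
  (measurable_summatory a).sub
    (((measurable_summatory a).comp (measurable_id.div_const α)).const_mul α)

theorem lipDiff_of_lt_one (a : ℕ → ℝ) {α x : ℝ} (hα : 1 ≤ α) (hx : x < 1) :
    lipDiff a α x = 0 := by
  have : x / α < 1 := by
    rw [div_lt_one (by linarith)]; linarith
  rw [lipDiff, summatory_of_lt_one a hx, summatory_of_lt_one a this]; simp

theorem abs_lipDiff_le {a : ℕ → ℝ} (ha : ∀ n, |a n| ≤ 1) {α x : ℝ} (hα : 1 ≤ α) (hx : 0 ≤ x) :
    |lipDiff a α x| ≤ 2 * x := by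
  have hα0 : 0 < α := by linarith
  have h1 := abs_summatory_le ha hx
  have h2 := abs_summatory_le ha (show 0 ≤ x / α by positivity)
  have h3 : |α * summatory a (x / α)| ≤ x := by
    rw [abs_mul, abs_of_pos hα0]
    calc _ ≤ α * (x / α) := by gcongr
      _ = x := by field_simp
  have := abs_sub (summatory a x) (α * summatory a (x / α))
  rw [lipDiff]; linarith

theorem abs_summatory_mul_log_sub_le {a : ℕ → ℝ} (ha : ∀ n, |a n| ≤ 1) {x : ℝ} (hx : 0 < x) :
    |summatory a x * Real.log x - summatory (fun n => a n * Real.log n) x| ≤ x := by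
  rw [summatory, summatory, Finset.sum_mul, ← Finset.sum_sub_distrib]
  refine (Finset.abs_sum_le_sum_abs _ _).trans (le_trans ?_ (sum_log_div_natCast_le hx.le))
  refine Finset.sum_le_sum fun n hn => ?_
  obtain ⟨h1, h2⟩ := natCast_le_of_mem_Icc_floor hn
  have := Real.log_le_log (by linarith) h2
  rw [← mul_sub, abs_mul, abs_of_nonneg (by linarith : 0 ≤ Real.log x - Real.log n)]
  exact mul_le_of_le_one_left (by linarith) (ha n)

theorem abs_lipDiff_mul_log_sub_le {a : ℕ → ℝ} (ha : ∀ n, |a n| ≤ 1) {α x : ℝ} (hα : 1 ≤ α)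
    (hx : 0 < x) :
    |lipDiff a α x * Real.log x - lipDiff (fun n => a n * Real.log n) α x|
      ≤ x * (2 + Real.log α) := by
  have hα0 : 0 < α := by linarith
  have hxα : 0 < x / α := by positivity
  have hℓ := Real.log_nonneg hα
  have h1 := abs_summatory_mul_log_sub_le ha hx
  have h2 := abs_summatory_mul_log_sub_le ha hxα
  have h3 := abs_summatory_le ha hxα.le
  have e1 : x / α * α = x := by field_simp
  rw [Real.log_div hx.ne' hα0.ne'] at h2
  have e : lipDiff a α x * Real.log x - lipDiff (fun n => a n * Real.log n) α x
      = (summatory a x * Real.log x - summatory (fun n => a n * Real.log n) x)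
        - (α * (summatory a (x / α) * (Real.log x - Real.log α)
          - summatory (fun n => a n * Real.log n) (x / α))
        + α * Real.log α * summatory a (x / α)) := by
    simp only [lipDiff]; ring
  rw [e]
  have h4 : |α * (summatory a (x / α) * (Real.log x - Real.log α)
          - summatory (fun n => a n * Real.log n) (x / α))| ≤ x := by
    rw [abs_mul, abs_of_pos hα0]
    calc _ ≤ α * (x / α) := by gcongr
      _ = x := by linarith
  have h5 : |α * Real.log α * summatory a (x / α)| ≤ x * Real.log α := by
    rw [abs_mul, abs_of_nonneg (by positivity : 0 ≤ α * Real.log α)]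
    calc _ ≤ α * Real.log α * (x / α) := by gcongr
      _ = (x / α * α) * Real.log α := by ring
      _ = _ := by rw [e1]
  refine (abs_sub _ _).trans ?_
  have := abs_add_le (α * (summatory a (x / α) * (Real.log x - Real.log α)
          - summatory (fun n => a n * Real.log n) (x / α))) (α * Real.log α * summatory a (x / α))
  linarith

theorem abs_lipDiff_exp_mul_exp_neg_le {a : ℕ → ℝ} (ha : ∀ n, |a n| ≤ 1) {α : ℝ} (hα : 1 ≤ α)
    (y : ℝ) : |lipDiff a α (Real.exp y)| * Real.exp (-y) ≤ 2 := by
  have h := abs_lipDiff_le ha hα (Real.exp_pos y).le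
  calc _ ≤ 2 * Real.exp y * Real.exp (-y) := by gcongr
    _ = 2 := by rw [mul_assoc, ← Real.exp_add]; simp

theorem measurable_abs_lipDiff_exp_mul (a : ℕ → ℝ) (α : ℝ) :
    Measurable fun y => |lipDiff a α (Real.exp y)| * Real.exp (-y) :=
  ((measurable_lipDiff a α).comp Real.measurable_exp).norm.mul
    (Real.measurable_exp.comp measurable_neg)

open MeasureTheory in
theorem intervalIntegrable_abs_lipDiff_exp_mul {a : ℕ → ℝ} (ha : ∀ n, |a n| ≤ 1) {α : ℝ}
    (hα : 1 ≤ α) (b c : ℝ) :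
    IntervalIntegrable (fun y => |lipDiff a α (Real.exp y)| * Real.exp (-y)) volume b c := by
  refine (intervalIntegrable_const (c := (2 : ℝ))).mono_fun'
    (measurable_abs_lipDiff_exp_mul a α).aestronglyMeasurable (.of_forall fun y => ?_)
  simp only
  rw [Real.norm_of_nonneg (by positivity)]
  exact abs_lipDiff_exp_mul_exp_neg_le ha hα y

open MeasureTheory in
theorem integral_abs_lipDiff_dyadic_le {φ : ℕ →*₀ ℝ} (hφ : ∀ n, |φ n| ≤ 1) {α L : ℝ}
    (hα : 1 ≤ α) (hL : 1 ≤ L) :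
    ∫ y in L..(2 * L), |lipDiff φ α (Real.exp y)| * Real.exp (-y)
      ≤ 1602 * (1 + Real.log α) * L ^ (3 / 4 : ℝ) := by
  have hL0 : 0 < L := by linarith
  set ℓ := Real.log α with hℓ
  have hℓ0 : 0 ≤ ℓ := Real.log_nonneg hα
  obtain ⟨wint, wle⟩ := integral_sq_lipDiff_mul_log_le hφ (σ := 1 / L) (by positivity)
    (by rw [div_le_one hL0]; exact hL) hα
  set w : ℝ → ℝ := fun y => lipDiff (fun n => φ n * Real.log n) α (Real.exp y)
    * Real.exp (-(1 + 1 / L) * y) with hw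
  have eA : (1 / L) ^ (-(5 / 2) : ℝ) = L ^ (5 / 2 : ℝ) := by
    rw [one_div, Real.inv_rpow hL0.le, Real.rpow_neg hL0.le, inv_inv]
  rw [eA] at wle
  set M : ℝ := 200 * (1 + ℓ) * L ^ (3 / 4 : ℝ) with hM
  have hM0 : 0 < M := by positivity
  have eM : M ^ 2 * L = 40000 * (1 + ℓ) ^ 2 * L ^ (5 / 2 : ℝ) := by
    have : L ^ (5 / 2 : ℝ) = (L ^ (3 / 4 : ℝ)) ^ 2 * L := by
      rw [← Real.rpow_natCast, ← Real.rpow_mul hL0.le]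
      nth_rewrite 3 [← Real.rpow_one L]
      rw [← Real.rpow_add hL0]; norm_num
    rw [this, hM]; ring
  have pw : ∀ y ∈ Set.Icc L (2 * L), |lipDiff φ α (Real.exp y)| * Real.exp (-y)
      ≤ (4 / (M * L)) * (w y) ^ 2 + (4 * M + (2 + ℓ)) / L := by
    intro y hy
    have hy0 : 0 < y := by linarith [hy.1]
    have h1 := abs_lipDiff_mul_log_sub_le hφ hα (Real.exp_pos y)
    rw [Real.log_exp] at h1
    have h2 : |lipDiff φ α (Real.exp y)| * y
        ≤ |lipDiff (fun n => φ n * Real.log n) α (Real.exp y)| + Real.exp y * (2 + ℓ) := by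
      have := abs_sub_abs_le_abs_sub (lipDiff φ α (Real.exp y) * y)
        (lipDiff (fun n => φ n * Real.log n) α (Real.exp y))
      rw [abs_mul, abs_of_pos hy0] at this
      linarith
    have h3 : |lipDiff (fun n => φ n * Real.log n) α (Real.exp y)| * Real.exp (-y)
        ≤ 8 * |w y| := by
      have e1 : |lipDiff (fun n => φ n * Real.log n) α (Real.exp y)| * Real.exp (-y)
          = Real.exp (y / L) * |w y| := by
        rw [hw]; simp only
        rw [abs_mul, Real.abs_exp, mul_left_comm, ← Real.exp_add]
        congr 2; ring
      rw [e1]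
      have : Real.exp (y / L) ≤ 8 := by
        have h : y / L ≤ 2 := by rw [div_le_iff₀ hL0]; exact hy.2
        have h' := Real.exp_le_exp.mpr h
        have : Real.exp 2 = Real.exp 1 * Real.exp 1 := by rw [← Real.exp_add]; norm_num
        nlinarith [Real.exp_one_lt_d9, Real.exp_pos 1]
      gcongr
    have h4 : 8 * |w y| ≤ 4 / M * (w y) ^ 2 + 4 * M := by
      have : 0 ≤ 4 / M * (|w y| - M) ^ 2 := by positivity
      have e : 4 / M * (|w y| - M) ^ 2 = 4 / M * (w y) ^ 2 + 4 * M - 8 * |w y| := by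
        rw [sub_sq, sq_abs]; field_simp; ring
      linarith
    have h5 : L * (|lipDiff φ α (Real.exp y)| * Real.exp (-y))
        ≤ 4 / M * (w y) ^ 2 + 4 * M + (2 + ℓ) := by
      have e : Real.exp y * (2 + ℓ) * Real.exp (-y) = 2 + ℓ := by
        rw [mul_right_comm, ← Real.exp_add]; simp
      have := mul_le_mul_of_nonneg_right h2 (Real.exp_pos (-y)).le
      rw [add_mul, e] at this
      have h6 : L * (|lipDiff φ α (Real.exp y)| * Real.exp (-y))
          ≤ |lipDiff φ α (Real.exp y)| * y * Real.exp (-y) := by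
        rw [mul_right_comm, mul_comm L]
        exact mul_le_mul_of_nonneg_left hy.1 (by positivity)
      linarith
    have e : (4 / (M * L)) * (w y) ^ 2 + (4 * M + (2 + ℓ)) / L
        = (4 / M * (w y) ^ 2 + 4 * M + (2 + ℓ)) / L := by field_simp; ring
    rw [e, le_div_iff₀ hL0, mul_comm]; exact h5
  have wii : IntervalIntegrable (fun y => (w y) ^ 2) volume L (2 * L) :=
    wint.intervalIntegrable
  have wii_le : ∫ y in L..(2 * L), (w y) ^ 2 ≤ M ^ 2 * L := by
    rw [eM, intervalIntegral.integral_of_le (by linarith)]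
    exact (setIntegral_le_integral wint (.of_forall fun y => sq_nonneg _)).trans wle
  have hL34 : 1 ≤ L ^ (3 / 4 : ℝ) := Real.one_le_rpow hL (by norm_num)
  calc _ ≤ ∫ y in L..(2 * L), ((4 / (M * L)) * (w y) ^ 2 + (4 * M + (2 + ℓ)) / L) :=
        intervalIntegral.integral_mono_on (by linarith)
          (intervalIntegrable_abs_lipDiff_exp_mul hφ hα _ _)
          ((wii.const_mul _).add intervalIntegrable_const) pw
    _ = (4 / (M * L)) * (∫ y in L..(2 * L), (w y) ^ 2) + (4 * M + (2 + ℓ)) := by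
        rw [intervalIntegral.integral_add (wii.const_mul _) intervalIntegrable_const,
          intervalIntegral.integral_const_mul, intervalIntegral.integral_const, smul_eq_mul]
        field_simp; ring
    _ ≤ (4 / (M * L)) * (M ^ 2 * L) + (4 * M + (2 + ℓ)) := by gcongr
    _ = 8 * M + (2 + ℓ) := by field_simp; ring
    _ ≤ _ := by
        rw [hM]
        nlinarith [mul_nonneg hℓ0 (by linarith : 0 ≤ L ^ (3 / 4 : ℝ) - 1)]

open MeasureTheory in
theorem integral_abs_lipDiff_le {φ : ℕ →*₀ ℝ} (hφ : ∀ n, |φ n| ≤ 1) {α Y : ℝ}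
    (hα : 1 ≤ α) (hY : 0 ≤ Y) :
    ∫ y in (0 : ℝ)..Y, |lipDiff φ α (Real.exp y)| * Real.exp (-y)
      ≤ 4 + 3204 * (1 + Real.log α) * Y ^ (3 / 4 : ℝ) := by
  have hℓ0 : 0 ≤ Real.log α := Real.log_nonneg hα
  have key : ∀ n : ℕ, ∀ Y : ℝ, 0 ≤ Y → Y ≤ 2 ^ n →
      ∫ y in (0 : ℝ)..Y, |lipDiff φ α (Real.exp y)| * Real.exp (-y)
        ≤ 4 + 3204 * (1 + Real.log α) * Y ^ (3 / 4 : ℝ) := by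
    intro n
    induction n with
    | zero =>
      intro Y hY hY1
      have : ∫ y in (0 : ℝ)..Y, |lipDiff φ α (Real.exp y)| * Real.exp (-y)
          ≤ ∫ y in (0 : ℝ)..Y, (2 : ℝ) :=
        intervalIntegral.integral_mono_on hY (intervalIntegrable_abs_lipDiff_exp_mul hφ hα _ _)
          intervalIntegrable_const fun y _ => abs_lipDiff_exp_mul_exp_neg_le hφ hα y
      rw [intervalIntegral.integral_const, smul_eq_mul] at this
      have : 0 ≤ 3204 * (1 + Real.log α) * Y ^ (3 / 4 : ℝ) := by positivity
      norm_num at hY1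
      linarith
    | succ n ih =>
      intro Y hY hY1
      have ih' := ih (Y / 2) (by positivity) (by rw [pow_succ] at hY1; linarith)
      rcases le_or_gt Y 2 with h2 | h2
      · have : ∫ y in (0 : ℝ)..Y, |lipDiff φ α (Real.exp y)| * Real.exp (-y)
            ≤ ∫ y in (0 : ℝ)..Y, (2 : ℝ) :=
          intervalIntegral.integral_mono_on hY (intervalIntegrable_abs_lipDiff_exp_mul hφ hα _ _)
            intervalIntegrable_const fun y _ => abs_lipDiff_exp_mul_exp_neg_le hφ hα y
        rw [intervalIntegral.integral_const, smul_eq_mul] at this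
        have : 0 ≤ 3204 * (1 + Real.log α) * Y ^ (3 / 4 : ℝ) := by positivity
        linarith
      · have hd := integral_abs_lipDiff_dyadic_le hφ hα (show 1 ≤ Y / 2 by linarith)
        rw [mul_div_cancel₀ Y (by norm_num)] at hd
        rw [← intervalIntegral.integral_add_adjacent_intervals
          (intervalIntegrable_abs_lipDiff_exp_mul hφ hα 0 (Y / 2))
          (intervalIntegrable_abs_lipDiff_exp_mul hφ hα (Y / 2) Y)]
        have e : Y ^ (3 / 4 : ℝ) = 2 ^ (3 / 4 : ℝ) * (Y / 2) ^ (3 / 4 : ℝ) := by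
          rw [← Real.mul_rpow (by norm_num) (by positivity)]; congr 1; ring
        have h34 : (3 / 2 : ℝ) ≤ 2 ^ (3 / 4 : ℝ) := by
          refine le_of_pow_le_pow_left₀ (n := 4) (by norm_num) (by positivity) ?_
          rw [← Real.rpow_natCast (2 ^ (3 / 4 : ℝ)), ← Real.rpow_mul (by norm_num)]
          norm_num
        have hp : 0 ≤ (1 + Real.log α) * (Y / 2) ^ (3 / 4 : ℝ) := by positivity
        rw [e]
        nlinarith
  obtain ⟨n, hn⟩ := pow_unbounded_of_one_lt Y (one_lt_two)
  exact key n Y hY hn.le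

theorem sum_divisorsAntidiagonal_Icc (N : ℕ) (g : ℕ → ℕ → ℝ) :
    ∑ n ∈ Finset.Icc 1 N, ∑ p ∈ n.divisorsAntidiagonal, g p.1 p.2
      = ∑ d ∈ Finset.Icc 1 N, ∑ m ∈ Finset.Icc 1 (N / d), g d m := by
  rw [Finset.sum_sigma', Finset.sum_sigma']
  refine Finset.sum_bij' (fun p _ => ⟨p.2.1, p.2.2⟩) (fun p _ => ⟨p.1 * p.2, (p.1, p.2)⟩)
    ?_ ?_ ?_ ?_ ?_
  · rintro ⟨n, d, m⟩ h
    simp only [Finset.mem_sigma, Finset.mem_Icc, Nat.mem_divisorsAntidiagonal] at h ⊢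
    obtain ⟨⟨h1, h2⟩, rfl, h3⟩ := h
    have hd : 0 < d := Nat.pos_of_ne_zero (left_ne_zero_of_mul h3)
    have hm : 0 < m := Nat.pos_of_ne_zero (right_ne_zero_of_mul h3)
    refine ⟨⟨hd, (Nat.le_mul_of_pos_right d hm).trans h2⟩, hm, ?_⟩
    rw [Nat.le_div_iff_mul_le hd, mul_comm]; exact h2
  · rintro ⟨d, m⟩ h
    simp only [Finset.mem_sigma, Finset.mem_Icc, Nat.mem_divisorsAntidiagonal] at h ⊢
    obtain ⟨⟨hd, h2⟩, hm, h3⟩ := h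
    rw [Nat.le_div_iff_mul_le hd, mul_comm] at h3
    have : 0 < d * m := Nat.mul_pos hd hm
    exact ⟨⟨this, h3⟩, trivial, this.ne'⟩
  · rintro ⟨n, d, m⟩ h
    simp only [Finset.mem_sigma, Nat.mem_divisorsAntidiagonal] at h
    obtain ⟨_, rfl, h3⟩ := h
    rfl
  · intros; rfl
  · intros; rfl

open ArithmeticFunction in
theorem sum_divisors_moebius_eq {n : ℕ} :
    ∑ d ∈ n.divisors, (moebius d : ℝ) = if n = 1 then 1 else 0 := by
  have h := congrArg (fun f : ArithmeticFunction ℝ => f n) (coe_moebius_mul_coe_zeta (R := ℝ))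
  simpa only [coe_mul_zeta_apply, one_apply, intCoe_apply] using h

open ArithmeticFunction in
theorem sum_divisors_moebius_mul_sub_log (n : ℕ) (c : ℝ) :
    ∑ d ∈ n.divisors, (moebius d : ℝ) * (c - Real.log d)
      = (if n = 1 then c else 0) + vonMangoldt n := by
  have h := sum_moebius_mul_log_eq (n := n)
  simp only [log_apply] at h
  simp only [mul_sub, Finset.sum_sub_distrib]
  rw [h, ← Finset.sum_mul, sum_divisors_moebius_eq]
  split_ifs <;> ring

open ArithmeticFunction in
theorem sum_moebius_mul_log_mul_sum (F : ℝ → ℝ) {x : ℝ} (hx : 1 ≤ x) :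
    ∑ d ∈ Finset.Icc 1 ⌊x⌋₊, (moebius d : ℝ) * Real.log (x / d)
        * ∑ m ∈ Finset.Icc 1 ⌊x / d⌋₊, F (x / d / m)
      = F x * Real.log x + ∑ n ∈ Finset.Icc 1 ⌊x⌋₊, vonMangoldt n * F (x / n) := by
  have h1 : ∀ d ∈ Finset.Icc 1 ⌊x⌋₊, (moebius d : ℝ) * Real.log (x / d)
        * ∑ m ∈ Finset.Icc 1 ⌊x / d⌋₊, F (x / d / m)
      = ∑ m ∈ Finset.Icc 1 (⌊x⌋₊ / d),
        (moebius d : ℝ) * (Real.log x - Real.log d) * F (x / (d * m : ℕ)) := by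
    intro d hd
    obtain ⟨h1, h2⟩ := natCast_le_of_mem_Icc_floor hd
    rw [Nat.floor_div_natCast, Real.log_div (by linarith) (by linarith), Finset.mul_sum]
    refine Finset.sum_congr rfl fun m _ => ?_
    rw [div_div, Nat.cast_mul]
  rw [Finset.sum_congr rfl h1, ← sum_divisorsAntidiagonal_Icc ⌊x⌋₊
    (fun d m => (moebius d : ℝ) * (Real.log x - Real.log d) * F (x / (d * m : ℕ)))]
  have h2 : ∀ n ∈ Finset.Icc 1 ⌊x⌋₊, ∑ p ∈ n.divisorsAntidiagonal,
      (moebius p.1 : ℝ) * (Real.log x - Real.log p.1) * F (x / (p.1 * p.2 : ℕ))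
      = (if n = 1 then F x * Real.log x else 0) + vonMangoldt n * F (x / n) := by
    intro n _
    have : ∀ p ∈ n.divisorsAntidiagonal,
        (moebius p.1 : ℝ) * (Real.log x - Real.log p.1) * F (x / (p.1 * p.2 : ℕ))
        = (moebius p.1 : ℝ) * (Real.log x - Real.log p.1) * F (x / n) := by
      intro p hp
      rw [(Nat.mem_divisorsAntidiagonal.mp hp).1]
    rw [Finset.sum_congr rfl this, Nat.sum_divisorsAntidiagonal
      (fun d _ => (moebius d : ℝ) * (Real.log x - Real.log d) * F (x / n)), ← Finset.sum_mul,
      sum_divisors_moebius_mul_sub_log, add_mul]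
    split_ifs with h
    · rw [h]; simp; ring
    · simp
  rw [Finset.sum_congr rfl h2, Finset.sum_add_distrib]
  congr 1
  rw [Finset.sum_ite_eq' (Finset.Icc 1 ⌊x⌋₊) 1, if_pos]
  simpa using hx

open ArithmeticFunction in
theorem psi_eq_sum_Icc_one (x : ℝ) :
    Chebyshev.psi x = ∑ n ∈ Finset.Icc 1 ⌊x⌋₊, vonMangoldt n := rfl

theorem psi_le_six_mul {x : ℝ} (hx : 0 ≤ x) : Chebyshev.psi x ≤ 6 * x := by
  refine (Chebyshev.psi_le_const_mul_self hx).trans ?_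
  gcongr
  have : Real.log 4 = 2 * Real.log 2 := by
    rw [show (4 : ℝ) = 2 ^ 2 by norm_num, Real.log_pow]; norm_num
  linarith [Real.log_two_lt_d9]

open ArithmeticFunction in
theorem sum_convolution_vonMangoldt (f : ArithmeticFunction ℝ) (x : ℝ) :
    ∑ n ∈ Finset.Icc 1 ⌊x⌋₊, (f * vonMangoldt) n
      = ∑ n ∈ Finset.Icc 1 ⌊x⌋₊, f n * Chebyshev.psi (x / n) := by
  refine (sum_Ioc_mul_eq_sum_sum f vonMangoldt ⌊x⌋₊).trans ?_
  refine Finset.sum_congr rfl fun n _ => ?_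
  rw [psi_eq_sum_Icc_one, Nat.floor_div_natCast]
  rfl

open ArithmeticFunction in
theorem sum_psi_div_eq_log_factorial (x : ℝ) :
    ∑ n ∈ Finset.Icc 1 ⌊x⌋₊, Chebyshev.psi (x / n) = Real.log ⌊x⌋₊.factorial := by
  rw [← sum_log_Icc_eq_log_factorial]
  have := sum_convolution_vonMangoldt (zeta : ArithmeticFunction ℝ) x
  rw [zeta_mul_vonMangoldt] at this
  simp only [log_apply] at this
  rw [this]
  refine Finset.sum_congr rfl fun n hn => ?_
  have : n ≠ 0 := by have := (Finset.mem_Icc.mp hn).1; omega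
  simp [this]

theorem log_factorial_le {N : ℕ} (hN : 1 ≤ N) :
    Real.log N.factorial ≤ N * Real.log N - N + 1 + Real.log N := by
  induction N, hN using Nat.le_induction with
  | base => simp
  | succ N hN ih =>
    have hN0 : (0 : ℝ) < N := by exact_mod_cast hN
    rw [Nat.factorial_succ, Nat.cast_mul, Real.log_mul (by positivity) (by positivity)]
    have h := Real.one_sub_inv_le_log_of_pos (show (0 : ℝ) < (N + 1) / N by positivity)
    rw [Real.log_div (by positivity) hN0.ne', inv_div] at h
    have h2 : (1 : ℝ) ≤ (N + 1) * (Real.log (N + 1) - Real.log N) := by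
      calc (1 : ℝ) = (N + 1) * (1 - N / (N + 1)) := by field_simp; ring
        _ ≤ _ := by gcongr
    push_cast
    linarith

theorem one_le_natFloor {x : ℝ} (hx : 1 ≤ x) : 1 ≤ ⌊x⌋₊ := Nat.le_floor (by simpa using hx)

theorem abs_log_factorial_floor_sub_le {y : ℝ} (hy : 1 ≤ y) :
    |Real.log ⌊y⌋₊.factorial - (y * Real.log y - y)| ≤ 2 + Real.log y := by
  have hy0 : 0 < y := by linarith
  have hN1 : (1 : ℝ) ≤ ⌊y⌋₊ := by exact_mod_cast one_le_natFloor hy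
  have hNy := Nat.floor_le hy0.le
  have hyN := Nat.lt_floor_add_one y
  have hlog := Real.log_nonneg hy
  have h1 := sum_log_div_natCast_le hy0.le
  rw [Finset.sum_sub_distrib, Finset.sum_const, Nat.card_Icc, Nat.add_sub_cancel, nsmul_eq_mul,
    sum_log_Icc_eq_log_factorial] at h1
  have h2 := log_factorial_le (one_le_natFloor hy)
  set N : ℝ := (⌊y⌋₊ : ℝ) with hN
  have h3 := Real.log_le_log (by linarith) hNy
  have h4 := Real.one_sub_inv_le_log_of_pos (show (0 : ℝ) < y / N by positivity)
  rw [Real.log_div hy0.ne' (by positivity), inv_div] at h4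
  have h5 : N * (1 - N / y) ≤ N * (Real.log y - Real.log N) := by gcongr
  have h8 : (y - N) ^ 2 / y ≤ 1 := by
    rw [div_le_one hy0]; nlinarith
  have h9 : N * (1 - N / y) = (y - N) - (y - N) ^ 2 / y := by field_simp; ring
  have h10 : 0 ≤ (y - N) * Real.log y := mul_nonneg (by linarith) hlog
  rw [abs_le]
  constructor
  · nlinarith
  · nlinarith

theorem abs_mul_harmonic_floor_sub_le {y : ℝ} (hy : 1 ≤ y) :
    |y * ((harmonic ⌊y⌋₊ : ℚ) : ℝ) - (y * Real.log y + Real.eulerMascheroniConstant * y)| ≤ 2 := by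
  have hy0 : 0 < y := by linarith
  have hN1 : (1 : ℝ) ≤ ⌊y⌋₊ := by exact_mod_cast one_le_natFloor hy
  have hNy := Nat.floor_le hy0.le
  have hyN := Nat.lt_floor_add_one y
  have a1 := Real.eulerMascheroniSeq_lt_eulerMascheroniConstant ⌊y⌋₊
  have a2 := Real.eulerMascheroniConstant_lt_eulerMascheroniSeq' ⌊y⌋₊
  rw [Real.eulerMascheroniSeq] at a1
  rw [Real.eulerMascheroniSeq', if_neg (by have := one_le_natFloor hy; omega)] at a2
  set N : ℝ := (⌊y⌋₊ : ℝ) with hN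
  set H : ℝ := ((harmonic ⌊y⌋₊ : ℚ) : ℝ)
  have b1 := Real.one_sub_inv_le_log_of_pos (show (0 : ℝ) < N / y by positivity)
  rw [Real.log_div (by positivity) hy0.ne', inv_div] at b1
  have b2 := Real.log_le_sub_one_of_pos (show (0 : ℝ) < (N + 1) / y by positivity)
  rw [Real.log_div (by positivity) hy0.ne'] at b2
  have c1 : y * (1 - y / N) ≥ -2 := by
    have : y * (1 - y / N) = -(y * (y - N) / N) := by field_simp; ring
    rw [this, ge_iff_le, neg_le_neg_iff, div_le_iff₀ (by linarith)]
    nlinarith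
  have c2 : y * ((N + 1) / y - 1) ≤ 1 := by
    have : y * ((N + 1) / y - 1) = N + 1 - y := by field_simp
    rw [this]; linarith
  have d1 : y * (1 - y / N) ≤ y * (H - Real.eulerMascheroniConstant - Real.log y) := by
    exact mul_le_mul_of_nonneg_left (by linarith) hy0.le
  have d2 : y * (H - Real.eulerMascheroniConstant - Real.log y) ≤ y * ((N + 1) / y - 1) := by
    exact mul_le_mul_of_nonneg_left (by linarith) hy0.le
  rw [abs_le]
  constructor <;> nlinarith

theorem sum_inv_sqrt_le (N : ℕ) : ∑ n ∈ Finset.Icc 1 N, (√(n : ℝ))⁻¹ ≤ 2 * √(N : ℝ) := by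
  induction N with
  | zero => simp
  | succ N ih =>
    rw [Finset.sum_Icc_succ_top (by omega)]
    have h0 : (0 : ℝ) < √((N + 1 : ℕ) : ℝ) := Real.sqrt_pos.mpr (by positivity)
    have h1 : √(N : ℝ) ^ 2 = N := Real.sq_sqrt (by positivity)
    have h2 : √((N + 1 : ℕ) : ℝ) ^ 2 = N + 1 := by
      rw [Real.sq_sqrt (by positivity)]; push_cast; rfl
    have h3 : (√((N + 1 : ℕ) : ℝ))⁻¹ ≤ 2 * √((N + 1 : ℕ) : ℝ) - 2 * √(N : ℝ) := by
      rw [inv_le_iff_one_le_mul₀' h0]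
      nlinarith [sq_nonneg (√((N + 1 : ℕ) : ℝ) - √(N : ℝ))]
    linarith

theorem sum_sqrt_div_le {x : ℝ} (hx : 0 ≤ x) :
    ∑ n ∈ Finset.Icc 1 ⌊x⌋₊, √(x / n) ≤ 2 * x := by
  have h : ∀ n ∈ Finset.Icc 1 ⌊x⌋₊, √(x / n) = √x * (√(n : ℝ))⁻¹ := by
    intro n _
    rw [Real.sqrt_div hx, div_eq_mul_inv]
  rw [Finset.sum_congr rfl h, ← Finset.mul_sum]
  calc _ ≤ √x * (2 * √(⌊x⌋₊ : ℝ)) := by gcongr; exact sum_inv_sqrt_le _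
    _ ≤ √x * (2 * √x) := by gcongr; exact Nat.floor_le hx
    _ = 2 * (√x * √x) := by ring
    _ = 2 * x := by rw [Real.mul_self_sqrt hx]

theorem abs_sum_psi_sub_le {y : ℝ} (hy : 1 ≤ y) :
    |∑ m ∈ Finset.Icc 1 ⌊y⌋₊,
      (Chebyshev.psi (y / m) - y / m + (Real.eulerMascheroniConstant + 1))| ≤ 6 + Real.log y := by
  have h1 := abs_log_factorial_floor_sub_le hy
  have h2 := abs_mul_harmonic_floor_sub_le hy
  have hy0 : 0 ≤ y := by linarith
  have h3 := Nat.floor_le hy0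
  have h4 := Nat.lt_floor_add_one y
  have g1 := Real.eulerMascheroniConstant_lt_two_thirds
  have g2 := Real.one_half_lt_eulerMascheroniConstant
  have e : ∑ m ∈ Finset.Icc 1 ⌊y⌋₊, y / m = y * ((harmonic ⌊y⌋₊ : ℚ) : ℝ) := by
    rw [harmonic_eq_sum_Icc, Rat.cast_sum, Finset.mul_sum]
    refine Finset.sum_congr rfl fun m _ => ?_
    push_cast
    rw [div_eq_mul_inv]
  rw [Finset.sum_add_distrib, Finset.sum_sub_distrib, sum_psi_div_eq_log_factorial, e,
    Finset.sum_const, Nat.card_Icc, Nat.add_sub_cancel, nsmul_eq_mul]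
  rw [abs_le] at h1 h2 ⊢
  constructor <;> nlinarith

theorem log_le_two_mul_sqrt {y : ℝ} (hy : 0 ≤ y) : Real.log y ≤ 2 * √y := by
  have := Real.log_le_rpow_div hy (show (0 : ℝ) < 1 / 2 by norm_num)
  rw [← Real.sqrt_eq_rpow] at this
  linarith

theorem six_add_log_mul_log_le {y : ℝ} (hy : 1 ≤ y) :
    (6 + Real.log y) * Real.log y ≤ 28 * √y := by
  have hs : 1 ≤ √y := Real.one_le_sqrt.mpr hy
  have h1 := log_le_two_mul_sqrt (show 0 ≤ √y by positivity)
  have h2 : Real.log √y = Real.log y / 2 := Real.log_sqrt (by linarith)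
  have h3 := log_le_two_mul_sqrt (show 0 ≤ y by linarith)
  have h4 := Real.sq_sqrt (show 0 ≤ √y by positivity)
  have h5 := Real.log_nonneg hy
  rw [h2] at h1
  nlinarith [Real.sqrt_nonneg √y]

open ArithmeticFunction in
theorem abs_psi_mul_log_add_sum_le {x : ℝ} (hx : 1 ≤ x) :
    |(Chebyshev.psi x - x + (Real.eulerMascheroniConstant + 1)) * Real.log x
      + ∑ n ∈ Finset.Icc 1 ⌊x⌋₊, vonMangoldt n
        * (Chebyshev.psi (x / n) - x / n + (Real.eulerMascheroniConstant + 1))| ≤ 56 * x := by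
  rw [← sum_moebius_mul_log_mul_sum
    (fun t => Chebyshev.psi t - t + (Real.eulerMascheroniConstant + 1)) hx]
  refine (Finset.abs_sum_le_sum_abs _ _).trans ?_
  have : ∀ d ∈ Finset.Icc 1 ⌊x⌋₊, |(moebius d : ℝ) * Real.log (x / d)
      * ∑ m ∈ Finset.Icc 1 ⌊x / d⌋₊, (Chebyshev.psi (x / d / m) - x / d / m
        + (Real.eulerMascheroniConstant + 1))| ≤ 28 * √(x / d) := by
    intro d hd
    obtain ⟨h1, h2⟩ := natCast_le_of_mem_Icc_floor hd
    have hy : 1 ≤ x / d := by rwa [one_le_div (by linarith)]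
    have hm : |(moebius d : ℝ)| ≤ 1 := by exact_mod_cast abs_moebius_le_one (n := d)
    have hl := Real.log_nonneg hy
    rw [abs_mul, abs_mul, abs_of_nonneg hl]
    calc _ ≤ 1 * Real.log (x / d) * (6 + Real.log (x / d)) := by
          gcongr; exact abs_sum_psi_sub_le hy
      _ = (6 + Real.log (x / d)) * Real.log (x / d) := by ring
      _ ≤ _ := six_add_log_mul_log_le hy
  refine (Finset.sum_le_sum this).trans ?_
  rw [← Finset.mul_sum]
  have := sum_sqrt_div_le (show 0 ≤ x by linarith)
  linarith

open ArithmeticFunction in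
theorem abs_sum_vonMangoldt_div_sub_log_le {N : ℕ} (hN : 1 ≤ N) :
    |N * ∑ n ∈ Finset.Icc 1 N, vonMangoldt n / n - N * Real.log N| ≤ 7 * N := by
  have hN0 : (1 : ℝ) ≤ N := by exact_mod_cast hN
  have h1 : ∑ n ∈ Finset.Icc 1 N, vonMangoldt n * ((N / n : ℕ) : ℝ) = Real.log N.factorial := by
    rw [← sum_log_Icc_eq_log_factorial]
    have := sum_Ioc_mul_zeta_eq_sum vonMangoldt N
    rw [vonMangoldt_mul_zeta] at this
    exact this.symm
  have h2 : ∀ n ∈ Finset.Icc 1 N, vonMangoldt n * (N / n : ℝ) - vonMangoldt n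
      ≤ vonMangoldt n * ((N / n : ℕ) : ℝ) := by
    intro n _
    have : (N / n : ℝ) ≤ ((N / n : ℕ) : ℝ) + 1 := by
      have := Nat.lt_floor_add_one ((N : ℝ) / n)
      rw [Nat.floor_div_eq_div] at this
      exact this.le
    nlinarith [vonMangoldt_nonneg (n := n)]
  have h3 : ∀ n ∈ Finset.Icc 1 N, vonMangoldt n * ((N / n : ℕ) : ℝ)
      ≤ vonMangoldt n * (N / n : ℝ) := by
    intro n _
    exact mul_le_mul_of_nonneg_left Nat.cast_div_le vonMangoldt_nonneg
  have h4 := Finset.sum_le_sum h2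
  have h5 := Finset.sum_le_sum h3
  have e : ∑ n ∈ Finset.Icc 1 N, vonMangoldt n * (N / n : ℝ)
      = N * ∑ n ∈ Finset.Icc 1 N, vonMangoldt n / n := by
    rw [Finset.mul_sum]
    exact Finset.sum_congr rfl fun n _ => by ring
  rw [Finset.sum_sub_distrib, h1, e] at h4
  rw [h1, e] at h5
  have h6 : ∑ n ∈ Finset.Icc 1 N, vonMangoldt n ≤ 6 * N := by
    have := psi_le_six_mul (show (0 : ℝ) ≤ N by positivity)
    rwa [psi_eq_sum_Icc_one, Nat.floor_natCast] at this
  have h7 := sum_log_div_natCast_le (show (0 : ℝ) ≤ N by positivity)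
  rw [Nat.floor_natCast, Finset.sum_sub_distrib, Finset.sum_const, Nat.card_Icc,
    Nat.add_sub_cancel, nsmul_eq_mul, sum_log_Icc_eq_log_factorial] at h7
  have h8 : Real.log N.factorial ≤ N * Real.log N := by
    rw [← Real.log_pow]
    exact Real.log_le_log (by positivity) (by exact_mod_cast Nat.factorial_le_pow N)
  rw [abs_le]; constructor <;> linarith

open ArithmeticFunction in
theorem sum_vonMangoldt_mul_log_div_le (N : ℕ) :
    ∑ n ∈ Finset.Icc 1 N, vonMangoldt n * (Real.log N - Real.log n) ≤ 6 * N := by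
  induction N with
  | zero => simp
  | succ N ih =>
    rcases Nat.eq_zero_or_pos N with rfl | hN
    · simp
    have hN0 : (0 : ℝ) < N := by exact_mod_cast hN
    rw [Finset.sum_Icc_succ_top (by omega), sub_self, mul_zero, add_zero]
    have e : ∑ n ∈ Finset.Icc 1 N, vonMangoldt n * (Real.log (N + 1 : ℕ) - Real.log n)
        = ∑ n ∈ Finset.Icc 1 N, vonMangoldt n * (Real.log N - Real.log n)
          + Chebyshev.psi N * (Real.log (N + 1 : ℕ) - Real.log N) := by
      rw [psi_eq_sum_Icc_one, Nat.floor_natCast, Finset.sum_mul, ← Finset.sum_add_distrib]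
      exact Finset.sum_congr rfl fun n _ => by ring
    rw [e]
    have h1 : Real.log (N + 1 : ℕ) - Real.log N ≤ 1 / N := by
      rw [← Real.log_div (by positivity) hN0.ne']
      refine (Real.log_le_sub_one_of_pos (by positivity)).trans (le_of_eq ?_)
      push_cast; field_simp; ring
    have h2 : Chebyshev.psi N * (Real.log (N + 1 : ℕ) - Real.log N) ≤ 6 * N * (1 / N) := by
      have := psi_le_six_mul hN0.le
      have : 0 ≤ Real.log (N + 1 : ℕ) - Real.log N :=
        sub_nonneg.mpr (Real.log_le_log hN0 (by push_cast; linarith))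
      gcongr
    have h3 : 6 * (N : ℝ) * (1 / N) = 6 := by field_simp
    push_cast at *
    linarith

open ArithmeticFunction in
/-- Selberg's symmetry formula. -/
theorem abs_sum_vonMangoldt_mul_log_add_sub_le {N : ℕ} (hN : 1 ≤ N) :
    |∑ n ∈ Finset.Icc 1 N, (vonMangoldt n * Real.log n + (vonMangoldt * vonMangoldt) n)
      - 2 * N * Real.log N| ≤ 100 * N := by
  have hN0 : (1 : ℝ) ≤ N := by exact_mod_cast hN
  have h1 := abs_psi_mul_log_add_sum_le hN0
  have h2 := abs_sum_vonMangoldt_div_sub_log_le hN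
  have h3 := sum_vonMangoldt_mul_log_div_le N
  have h4 := psi_le_six_mul (show (0 : ℝ) ≤ N by positivity)
  have h4' := Chebyshev.psi_nonneg N
  have h5 := Real.log_nonneg hN0
  have h6 := Real.log_le_sub_one_of_pos (show (0 : ℝ) < N by linarith)
  have h7 := sum_convolution_vonMangoldt vonMangoldt (N : ℝ)
  have h8 : 0 ≤ ∑ n ∈ Finset.Icc 1 N, vonMangoldt n * (Real.log N - Real.log n) := by
    refine Finset.sum_nonneg fun n hn => mul_nonneg vonMangoldt_nonneg (sub_nonneg.mpr ?_)
    obtain ⟨a, b⟩ := Finset.mem_Icc.mp hn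
    exact Real.log_le_log (by exact_mod_cast a) (by exact_mod_cast b)
  have e8 : ∑ n ∈ Finset.Icc 1 N, vonMangoldt n * (Real.log N - Real.log n)
      = Chebyshev.psi N * Real.log N - ∑ n ∈ Finset.Icc 1 N, vonMangoldt n * Real.log n := by
    rw [psi_eq_sum_Icc_one, Nat.floor_natCast, Finset.sum_mul, ← Finset.sum_sub_distrib]
    exact Finset.sum_congr rfl fun n _ => by ring
  have e1 : ∑ n ∈ Finset.Icc 1 N, vonMangoldt n
        * (Chebyshev.psi (N / n) - N / n + (Real.eulerMascheroniConstant + 1))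
      = ∑ n ∈ Finset.Icc 1 N, vonMangoldt n * Chebyshev.psi (N / n)
        - N * ∑ n ∈ Finset.Icc 1 N, vonMangoldt n / n
        + Chebyshev.psi N * (Real.eulerMascheroniConstant + 1) := by
    rw [psi_eq_sum_Icc_one, Nat.floor_natCast, Finset.sum_mul, Finset.mul_sum,
      ← Finset.sum_sub_distrib, ← Finset.sum_add_distrib]
    exact Finset.sum_congr rfl fun n _ => by ring
  rw [Nat.floor_natCast] at h1 h7
  rw [e1, ← h7] at h1
  rw [e8] at h3 h8
  rw [Finset.sum_add_distrib]
  have g1 := Real.eulerMascheroniConstant_lt_two_thirds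
  have g2 := Real.one_half_lt_eulerMascheroniConstant
  have k1 : (Real.eulerMascheroniConstant + 1) * (Real.log N + Chebyshev.psi N) ≤ 2 * (7 * N) := by
    gcongr <;> linarith
  have k2 : 0 ≤ (Real.eulerMascheroniConstant + 1) * (Real.log N + Chebyshev.psi N) := by
    apply mul_nonneg <;> linarith
  rw [abs_le] at h1 h2 ⊢
  constructor <;> linarith

theorem abs_summatory_sub_le {a : ℕ → ℝ} (ha : ∀ n, |a n| ≤ 1) {u v : ℝ} (huv : u ≤ v) :
    |summatory a v - summatory a u| ≤ (⌊v⌋₊ : ℝ) - ⌊u⌋₊ := by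
  have hf : ⌊u⌋₊ ≤ ⌊v⌋₊ := Nat.floor_mono huv
  have h1 : Finset.Icc 1 ⌊u⌋₊ ⊆ Finset.Icc 1 ⌊v⌋₊ := Finset.Icc_subset_Icc le_rfl hf
  rw [summatory, summatory, ← Finset.sum_sdiff h1, add_sub_cancel_right]
  refine (Finset.abs_sum_le_sum_abs _ _).trans
    ((Finset.sum_le_card_nsmul _ _ 1 fun n _ => ha n).trans ?_)
  rw [Finset.card_sdiff_of_subset h1]
  simp [Nat.cast_sub hf]

/-- The nondecreasing step function controlling the variation of `lipDiff a α` when `|a| ≤ 1`. -/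
noncomputable def lipStep (α x : ℝ) : ℝ := ⌊x⌋₊ + α * ⌊x / α⌋₊

theorem lipStep_mono {α : ℝ} (hα : 0 < α) : Monotone (lipStep α) := by
  intro u v huv
  unfold lipStep
  gcongr

theorem lipStep_nonneg {α : ℝ} (hα : 0 < α) (x : ℝ) : 0 ≤ lipStep α x := by
  unfold lipStep; positivity

theorem lipStep_le {α x : ℝ} (hα : 0 < α) (hx : 0 ≤ x) : lipStep α x ≤ 2 * x := by
  have h1 := Nat.floor_le hx
  have h2 := mul_le_mul_of_nonneg_left (Nat.floor_le (show 0 ≤ x / α by positivity)) hα.le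
  rw [mul_div_cancel₀ x hα.ne'] at h2
  unfold lipStep; linarith

theorem abs_lipDiff_sub_le {a : ℕ → ℝ} (ha : ∀ n, |a n| ≤ 1) {α u v : ℝ} (hα : 0 < α)
    (huv : u ≤ v) : |lipDiff a α v - lipDiff a α u| ≤ lipStep α v - lipStep α u := by
  have h1 := abs_summatory_sub_le ha huv
  have h2 := abs_summatory_sub_le ha (show u / α ≤ v / α by gcongr)
  have h3 := mul_le_mul_of_nonneg_left h2 hα.le
  rw [← abs_of_pos hα, ← abs_mul, abs_of_pos hα] at h3
  have e : lipDiff a α v - lipDiff a α u = (summatory a v - summatory a u)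
    - α * (summatory a (v / α) - summatory a (u / α)) := by unfold lipDiff; ring
  rw [e]
  refine (abs_sub _ _).trans ?_
  unfold lipStep; linarith

open ArithmeticFunction in
theorem summatory_mul_log_eq (φ : ℕ →*₀ ℝ) {x : ℝ} {M : ℕ} (hM : ⌊x⌋₊ ≤ M) :
    summatory (fun n => φ n * Real.log n) x
      = ∑ d ∈ Finset.Icc 1 M, φ d * vonMangoldt d * summatory φ (x / d) := by
  have h1 : ∑ d ∈ Finset.Icc 1 M, φ d * vonMangoldt d * summatory φ (x / d)
      = ∑ d ∈ Finset.Icc 1 ⌊x⌋₊, φ d * vonMangoldt d * summatory φ (x / d) := by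
    symm
    refine Finset.sum_subset (Finset.Icc_subset_Icc le_rfl hM) fun d hd hd' => ?_
    have h1 := (Finset.mem_Icc.mp hd).1
    have h2 : ⌊x⌋₊ < d := by
      by_contra h
      exact hd' (Finset.mem_Icc.mpr ⟨h1, by omega⟩)
    have hd0 : (0 : ℝ) < d := by exact_mod_cast h1
    rw [summatory_of_lt_one, mul_zero]
    rw [div_lt_one hd0]
    exact (Nat.floor_lt' (by omega)).mp h2
  have h2 : ∀ d ∈ Finset.Icc 1 ⌊x⌋₊, φ d * vonMangoldt d * summatory φ (x / d)
      = ∑ m ∈ Finset.Icc 1 (⌊x⌋₊ / d), vonMangoldt d * φ (d * m) := by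
    intro d _
    rw [summatory, Nat.floor_div_natCast, Finset.mul_sum]
    refine Finset.sum_congr rfl fun m _ => ?_
    rw [map_mul]; ring
  rw [h1, Finset.sum_congr rfl h2, ← sum_divisorsAntidiagonal_Icc ⌊x⌋₊
    (fun d m => vonMangoldt d * φ (d * m)), summatory]
  refine Finset.sum_congr rfl fun n _ => ?_
  have : ∀ p ∈ n.divisorsAntidiagonal, vonMangoldt p.1 * φ (p.1 * p.2)
      = vonMangoldt p.1 * φ n := by
    intro p hp
    rw [(Nat.mem_divisorsAntidiagonal.mp hp).1]
  rw [Finset.sum_congr rfl this, Nat.sum_divisorsAntidiagonal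
    (fun d _ => vonMangoldt d * φ n), ← Finset.sum_mul, vonMangoldt_sum, mul_comm]

open ArithmeticFunction in
theorem lipDiff_mul_log_eq (φ : ℕ →*₀ ℝ) {α x : ℝ} (hα : 1 ≤ α) (hx : 0 ≤ x) :
    lipDiff (fun n => φ n * Real.log n) α x
      = ∑ d ∈ Finset.Icc 1 ⌊x⌋₊, φ d * vonMangoldt d * lipDiff φ α (x / d) := by
  have hle : ⌊x / α⌋₊ ≤ ⌊x⌋₊ := Nat.floor_mono (div_le_self hx hα)
  rw [lipDiff, summatory_mul_log_eq φ le_rfl, summatory_mul_log_eq φ hle, Finset.mul_sum,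
    ← Finset.sum_sub_distrib]
  refine Finset.sum_congr rfl fun d _ => ?_
  rw [lipDiff, div_right_comm]; ring

open ArithmeticFunction in
theorem abs_lipDiff_mul_log_le {φ : ℕ →*₀ ℝ} (hφ : ∀ n, |φ n| ≤ 1) {α x : ℝ} (hα : 1 ≤ α)
    (hx : 1 ≤ x) :
    |lipDiff φ α x| * Real.log x
      ≤ ∑ d ∈ Finset.Icc 1 ⌊x⌋₊, vonMangoldt d * |lipDiff φ α (x / d)|
        + (2 + Real.log α) * x := by
  have h1 := abs_lipDiff_mul_log_sub_le hφ hα (show 0 < x by linarith)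
  have h2 : |lipDiff (fun n => φ n * Real.log n) α x|
      ≤ ∑ d ∈ Finset.Icc 1 ⌊x⌋₊, vonMangoldt d * |lipDiff φ α (x / d)| := by
    rw [lipDiff_mul_log_eq φ hα (by linarith)]
    refine (Finset.abs_sum_le_sum_abs _ _).trans (Finset.sum_le_sum fun d _ => ?_)
    rw [abs_mul, abs_mul, abs_of_nonneg (vonMangoldt_nonneg (n := d))]
    gcongr
    exact mul_le_of_le_one_left vonMangoldt_nonneg (hφ d)
  have h3 := abs_sub_abs_le_abs_sub (lipDiff φ α x * Real.log x)
    (lipDiff (fun n => φ n * Real.log n) α x)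
  rw [abs_mul, abs_of_nonneg (Real.log_nonneg hx)] at h3
  linarith

open ArithmeticFunction in
theorem sum_vonMangoldt_div_le {x : ℝ} (hx : 1 ≤ x) :
    ∑ d ∈ Finset.Icc 1 ⌊x⌋₊, vonMangoldt d / d ≤ Real.log x + 7 := by
  have hN := one_le_natFloor hx
  have h := (abs_le.mp (abs_sum_vonMangoldt_div_sub_log_le hN)).2
  have hN0 : (0 : ℝ) < ⌊x⌋₊ := by exact_mod_cast hN
  have h2 := Real.log_le_log hN0 (Nat.floor_le (by linarith))
  have : ∑ d ∈ Finset.Icc 1 ⌊x⌋₊, vonMangoldt d / d ≤ Real.log ⌊x⌋₊ + 7 :=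
    le_of_mul_le_mul_left (by linarith) hN0
  linarith

open ArithmeticFunction in
theorem abs_lipDiff_mul_log_sq_le {φ : ℕ →*₀ ℝ} (hφ : ∀ n, |φ n| ≤ 1) {α x : ℝ} (hα : 1 ≤ α)
    (hx : 1 ≤ x) :
    |lipDiff φ α x| * Real.log x ^ 2
      ≤ ∑ n ∈ Finset.Icc 1 ⌊x⌋₊, (vonMangoldt n * Real.log n + (vonMangoldt * vonMangoldt) n)
          * |lipDiff φ α (x / n)|
        + (2 + Real.log α) * x * (2 * Real.log x + 7) := by
  set K : ℝ := 2 + Real.log α with hK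
  have hK0 : 0 ≤ K := by have := Real.log_nonneg hα; linarith
  have hx0 : 0 < x := by linarith
  have hl := Real.log_nonneg hx
  have h1 := mul_le_mul_of_nonneg_right (abs_lipDiff_mul_log_le hφ hα hx) hl
  have h2 : ∀ d ∈ Finset.Icc 1 ⌊x⌋₊, vonMangoldt d * |lipDiff φ α (x / d)| * Real.log x
      ≤ vonMangoldt d * Real.log d * |lipDiff φ α (x / d)|
        + ∑ m ∈ Finset.Icc 1 (⌊x⌋₊ / d), vonMangoldt d * vonMangoldt m
          * |lipDiff φ α (x / (d * m : ℕ))| + K * x * (vonMangoldt d / d) := by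
    intro d hd
    obtain ⟨hd1, hd2⟩ := natCast_le_of_mem_Icc_floor hd
    have hd0 : (0 : ℝ) < d := by linarith
    have h := mul_le_mul_of_nonneg_left
      (abs_lipDiff_mul_log_le hφ hα (show 1 ≤ x / d by rwa [one_le_div hd0]))
      (vonMangoldt_nonneg (n := d))
    rw [Real.log_div hx0.ne' hd0.ne', mul_add, Finset.mul_sum, Nat.floor_div_natCast] at h
    have e : ∑ m ∈ Finset.Icc 1 (⌊x⌋₊ / d), vonMangoldt d * (vonMangoldt m
          * |lipDiff φ α (x / d / m)|) = ∑ m ∈ Finset.Icc 1 (⌊x⌋₊ / d), vonMangoldt d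
          * vonMangoldt m * |lipDiff φ α (x / (d * m : ℕ))| := by
      refine Finset.sum_congr rfl fun m _ => ?_
      rw [div_div, Nat.cast_mul]; ring
    rw [e] at h
    have e2 : vonMangoldt d * (K * (x / d)) = K * x * (vonMangoldt d / d) := by ring
    rw [e2] at h
    linarith
  have h3 := Finset.sum_le_sum h2
  rw [← Finset.sum_mul, Finset.sum_add_distrib, Finset.sum_add_distrib, ← Finset.mul_sum,
    ← sum_divisorsAntidiagonal_Icc ⌊x⌋₊ (fun d m => vonMangoldt d * vonMangoldt m
          * |lipDiff φ α (x / (d * m : ℕ))|)] at h3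
  have e3 : ∀ n ∈ Finset.Icc 1 ⌊x⌋₊, ∑ p ∈ n.divisorsAntidiagonal,
      vonMangoldt p.1 * vonMangoldt p.2 * |lipDiff φ α (x / (p.1 * p.2 : ℕ))|
      = (vonMangoldt * vonMangoldt) n * |lipDiff φ α (x / n)| := by
    intro n _
    rw [mul_apply, Finset.sum_mul]
    refine Finset.sum_congr rfl fun p hp => ?_
    rw [(Nat.mem_divisorsAntidiagonal.mp hp).1]
  rw [Finset.sum_congr rfl e3] at h3
  have h4 := mul_le_mul_of_nonneg_left (sum_vonMangoldt_div_le hx) (mul_nonneg hK0 hx0.le)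
  simp only [add_mul, Finset.sum_add_distrib] at h1 h3 ⊢
  rw [pow_two, ← mul_assoc]
  nlinarith

theorem sum_mul_eq_sum_partial_sum_mul_sub (a G : ℕ → ℝ) (N : ℕ) :
    ∑ n ∈ Finset.Icc 1 N, a n * G n
      = (∑ n ∈ Finset.Icc 1 N, a n) * G (N + 1)
        + ∑ n ∈ Finset.Icc 1 N, (∑ k ∈ Finset.Icc 1 n, a k) * (G n - G (n + 1)) := by
  induction N with
  | zero => simp
  | succ N ih =>
    rw [Finset.sum_Icc_succ_top (by omega), ih, Finset.sum_Icc_succ_top (by omega),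
      Finset.sum_Icc_succ_top (by omega), Finset.sum_Icc_succ_top (by omega)]
    ring

theorem sum_natCast_mul_sub (g : ℕ → ℝ) (N : ℕ) :
    ∑ n ∈ Finset.Icc 1 N, (n : ℝ) * (g n - g (n + 1))
      = ∑ n ∈ Finset.Icc 1 N, g n - N * g (N + 1) := by
  induction N with
  | zero => simp
  | succ N ih =>
    rw [Finset.sum_Icc_succ_top (by omega), ih, Finset.sum_Icc_succ_top (by omega)]
    push_cast; ring

theorem sum_sub_succ (g : ℕ → ℝ) (N : ℕ) :
    ∑ n ∈ Finset.Icc 1 N, (g n - g (n + 1)) = g 1 - g (N + 1) := by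
  induction N with
  | zero => simp
  | succ N ih =>
    rw [Finset.sum_Icc_succ_top (by omega), ih]; ring

theorem sum_inv_le_one_add_log {x : ℝ} (hx : 1 ≤ x) :
    ∑ n ∈ Finset.Icc 1 ⌊x⌋₊, (n : ℝ)⁻¹ ≤ 1 + Real.log x := by
  have h := harmonic_le_one_add_log ⌊x⌋₊
  rw [harmonic_eq_sum_Icc, Rat.cast_sum] at h
  have h2 := Real.log_le_log (by exact_mod_cast one_le_natFloor hx)
    (Nat.floor_le (show 0 ≤ x by linarith))
  push_cast at h
  linarith

theorem div_natCast_succ_le {x : ℝ} (hx : 0 ≤ x) {d : ℕ} (hd : 1 ≤ d) :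
    x / (d + 1 : ℕ) ≤ x / d := by
  have : (0 : ℝ) < d := by exact_mod_cast hd
  gcongr
  simp

theorem lipDiff_div_floor_succ (a : ℕ → ℝ) {α x : ℝ} (hα : 1 ≤ α) :
    lipDiff a α (x / (⌊x⌋₊ + 1 : ℕ)) = 0 := by
  apply lipDiff_of_lt_one a hα
  rw [div_lt_one (by positivity)]
  push_cast
  exact Nat.lt_floor_add_one x

open ArithmeticFunction in
theorem abs_sum_selberg_sub_two_log_le {N : ℕ} (hN : 1 ≤ N) :
    |∑ n ∈ Finset.Icc 1 N, (vonMangoldt n * Real.log n + (vonMangoldt * vonMangoldt) n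
      - 2 * Real.log n)| ≤ 102 * N := by
  have h1 := abs_sum_vonMangoldt_mul_log_add_sub_le hN
  have h7 := sum_log_div_natCast_le (show (0 : ℝ) ≤ N by positivity)
  rw [Nat.floor_natCast, Finset.sum_sub_distrib, Finset.sum_const, Nat.card_Icc,
    Nat.add_sub_cancel, nsmul_eq_mul] at h7
  have h8 : ∑ n ∈ Finset.Icc 1 N, Real.log n ≤ N * Real.log N := by
    rw [sum_log_Icc_eq_log_factorial, ← Real.log_pow]
    exact Real.log_le_log (by positivity) (by exact_mod_cast Nat.factorial_le_pow N)
  rw [Finset.sum_sub_distrib, ← Finset.mul_sum]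
  rw [abs_le] at h1 ⊢
  constructor <;> linarith

open ArithmeticFunction in
theorem sum_selberg_mul_abs_lipDiff_le {a : ℕ → ℝ} (ha : ∀ n, |a n| ≤ 1) {α x : ℝ} (hα : 1 ≤ α)
    (hx : 1 ≤ x) :
    ∑ n ∈ Finset.Icc 1 ⌊x⌋₊, (vonMangoldt n * Real.log n + (vonMangoldt * vonMangoldt) n)
        * |lipDiff a α (x / n)|
      ≤ 2 * ∑ n ∈ Finset.Icc 1 ⌊x⌋₊, Real.log n * |lipDiff a α (x / n)|
        + 204 * x * (1 + Real.log x) := by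
  have hα0 : 0 < α := by linarith
  have hx0 : 0 ≤ x := by linarith
  have h1 := sum_mul_eq_sum_partial_sum_mul_sub
    (fun n => vonMangoldt n * Real.log n + (vonMangoldt * vonMangoldt) n - 2 * Real.log n)
    (fun n => |lipDiff a α (x / n)|) ⌊x⌋₊
  simp only [lipDiff_div_floor_succ a hα, abs_zero, mul_zero, zero_add] at h1
  have h2 : ∀ n ∈ Finset.Icc 1 ⌊x⌋₊,
      (∑ k ∈ Finset.Icc 1 n, (vonMangoldt k * Real.log k + (vonMangoldt * vonMangoldt) k
        - 2 * Real.log k)) * (|lipDiff a α (x / n)| - |lipDiff a α (x / (n + 1 : ℕ))|)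
      ≤ 102 * (n * (lipStep α (x / n) - lipStep α (x / (n + 1 : ℕ)))) := by
    intro n hn
    have hn1 := (Finset.mem_Icc.mp hn).1
    have b1 := abs_sum_selberg_sub_two_log_le hn1
    have b2 := abs_lipDiff_sub_le ha hα0 (div_natCast_succ_le hx0 hn1)
    have b3 := abs_abs_sub_abs_le_abs_sub (lipDiff a α (x / n)) (lipDiff a α (x / (n + 1 : ℕ)))
    refine (le_abs_self _).trans ?_
    rw [abs_mul, ← mul_assoc]
    gcongr
    exact b3.trans b2
  have h3 := Finset.sum_le_sum h2
  rw [← h1, ← Finset.mul_sum, sum_natCast_mul_sub (fun n => lipStep α (x / n))] at h3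
  have h4 : ∑ n ∈ Finset.Icc 1 ⌊x⌋₊, lipStep α (x / n) ≤ 2 * x * (1 + Real.log x) := by
    calc _ ≤ ∑ n ∈ Finset.Icc 1 ⌊x⌋₊, 2 * x * (n : ℝ)⁻¹ := by
          refine Finset.sum_le_sum fun n _ => ?_
          refine (lipStep_le hα0 (by positivity)).trans (le_of_eq ?_)
          rw [div_eq_mul_inv]; ring
      _ ≤ _ := by
          rw [← Finset.mul_sum]
          gcongr
          exact sum_inv_le_one_add_log hx
  have h5 : 0 ≤ (⌊x⌋₊ : ℝ) * lipStep α (x / (⌊x⌋₊ + 1 : ℕ)) :=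
    mul_nonneg (by positivity) (lipStep_nonneg hα0 _)
  simp only [sub_mul, Finset.sum_sub_distrib, mul_assoc, ← Finset.mul_sum] at h3 ⊢
  linarith

open MeasureTheory in
theorem abs_lipDiff_sub_le_integral {a : ℕ → ℝ} (ha : ∀ n, |a n| ≤ 1) {α x : ℝ} (hα : 1 ≤ α)
    (hx : 0 < x) {d : ℕ} (hd : 1 ≤ d) :
    |lipDiff a α (x / d)| - (lipStep α (x / d) - lipStep α (x / (d + 1 : ℕ)))
      ≤ x * ∫ y in (Real.log (x / (d + 1 : ℕ)))..(Real.log (x / d)),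
        |lipDiff a α (Real.exp y)| * Real.exp (-y) := by
  have hα0 : 0 < α := by linarith
  have hd0 : (0 : ℝ) < d := by exact_mod_cast hd
  have hd1 : (0 : ℝ) < (d + 1 : ℕ) := by positivity
  set c := |lipDiff a α (x / d)| - (lipStep α (x / d) - lipStep α (x / (d + 1 : ℕ)))
  have hle := div_natCast_succ_le hx.le hd
  have hlog := Real.log_le_log (by positivity) hle
  have h1 : ∫ y in (Real.log (x / (d + 1 : ℕ)))..(Real.log (x / d)), c * Real.exp (-y)
      ≤ ∫ y in (Real.log (x / (d + 1 : ℕ)))..(Real.log (x / d)),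
        |lipDiff a α (Real.exp y)| * Real.exp (-y) := by
    refine intervalIntegral.integral_mono_on hlog (Continuous.intervalIntegrable (by fun_prop) _ _)
      (intervalIntegrable_abs_lipDiff_exp_mul ha hα _ _) fun y hy => ?_
    gcongr
    have y1 : x / (d + 1 : ℕ) ≤ Real.exp y := by
      rw [← Real.log_le_iff_le_exp (by positivity)]; exact hy.1
    have y2 : Real.exp y ≤ x / d := by
      rw [← Real.le_log_iff_exp_le (by positivity)]; exact hy.2
    have b := abs_lipDiff_sub_le ha hα0 y2
    have b' := lipStep_mono hα0 y1
    have b3 := abs_sub_abs_le_abs_sub (lipDiff a α (x / d)) (lipDiff a α (Real.exp y))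
    simp only [c]
    linarith
  have h2 : ∫ y in (Real.log (x / (d + 1 : ℕ)))..(Real.log (x / d)), c * Real.exp (-y)
      = c / x := by
    rw [intervalIntegral.integral_const_mul,
      intervalIntegral.integral_comp_neg (fun y => Real.exp y), integral_exp,
      Real.exp_neg, Real.exp_neg, Real.exp_log (by positivity), Real.exp_log (by positivity)]
    push_cast; field_simp; ring
  rw [h2, div_le_iff₀ hx] at h1
  linarith

open MeasureTheory in
theorem sum_abs_lipDiff_le_integral {a : ℕ → ℝ} (ha : ∀ n, |a n| ≤ 1) {α x : ℝ} (hα : 1 ≤ α)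
    (hx : 1 ≤ x) :
    ∑ d ∈ Finset.Icc 1 ⌊x⌋₊, |lipDiff a α (x / d)|
      ≤ x * (∫ y in (0 : ℝ)..(Real.log x), |lipDiff a α (Real.exp y)| * Real.exp (-y))
        + 2 * x + 2 := by
  have hx0 : 0 < x := by linarith
  have hα0 : 0 < α := by linarith
  have hii := intervalIntegrable_abs_lipDiff_exp_mul ha hα
  have key : ∀ N : ℕ, ∑ d ∈ Finset.Icc 1 N,
      (|lipDiff a α (x / d)| - (lipStep α (x / d) - lipStep α (x / (d + 1 : ℕ))))
      ≤ x * ∫ y in (Real.log (x / (N + 1 : ℕ)))..(Real.log x),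
        |lipDiff a α (Real.exp y)| * Real.exp (-y) := by
    intro N
    induction N with
    | zero => simp
    | succ N ih =>
      rw [Finset.sum_Icc_succ_top (by omega),
        ← intervalIntegral.integral_add_adjacent_intervals (hii _ (Real.log (x / (N + 1 : ℕ))))
          (hii _ _), mul_add]
      have := abs_lipDiff_sub_le_integral ha hα hx0 (d := N + 1) (by omega)
      linarith
  have h1 := key ⌊x⌋₊
  rw [Finset.sum_sub_distrib, sum_sub_succ (fun d => lipStep α (x / d)),
    ← intervalIntegral.integral_add_adjacent_intervals (hii _ 0) (hii 0 _)] at h1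
  have h2 := lipStep_le hα0 hx0.le
  have h3 := lipStep_nonneg hα0 (x / (⌊x⌋₊ + 1 : ℕ))
  have hN : (0 : ℝ) < (⌊x⌋₊ + 1 : ℕ) := by positivity
  have hlt : x ≤ (⌊x⌋₊ + 1 : ℕ) := by push_cast; exact (Nat.lt_floor_add_one x).le
  have hneg : Real.log (x / (⌊x⌋₊ + 1 : ℕ)) ≤ 0 :=
    Real.log_nonpos (by positivity) (by rwa [div_le_one hN])
  have hlen : -Real.log (x / (⌊x⌋₊ + 1 : ℕ)) ≤ 1 / x := by
    rw [← Real.log_inv, inv_div]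
    refine (Real.log_le_sub_one_of_pos (by positivity)).trans ?_
    rw [div_sub_one hx0.ne']
    gcongr
    push_cast
    linarith [Nat.floor_le hx0.le]
  have h4 : ∫ y in (Real.log (x / (⌊x⌋₊ + 1 : ℕ)))..(0 : ℝ),
      |lipDiff a α (Real.exp y)| * Real.exp (-y) ≤ 2 * (1 / x) := by
    calc _ ≤ ∫ y in (Real.log (x / (⌊x⌋₊ + 1 : ℕ)))..(0 : ℝ), (2 : ℝ) :=
          intervalIntegral.integral_mono_on hneg (hii _ _) intervalIntegrable_const
            fun y _ => abs_lipDiff_exp_mul_exp_neg_le ha hα y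
      _ ≤ _ := by rw [intervalIntegral.integral_const, smul_eq_mul]; linarith
  have h5 := mul_le_mul_of_nonneg_left h4 hx0.le
  have h6 : x * (2 * (1 / x)) = 2 := by field_simp
  simp only [Nat.cast_one, div_one] at h1
  linarith

/-- A quantitative Lipschitz bound for mean values of real multiplicative functions. -/
theorem abs_lipDiff_le_mul_rpow_log {φ : ℕ →*₀ ℝ} (hφ : ∀ n, |φ n| ≤ 1) {α x : ℝ} (hα : 1 ≤ α)
    (hx : 1 ≤ Real.log x) (hx0 : 0 < x) :
    |lipDiff φ α x| ≤ 7000 * (1 + Real.log α) * x * Real.log x ^ (-(1 / 4) : ℝ) := by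
  have hx1 : 1 ≤ x := by
    by_contra h
    have := Real.log_nonpos hx0.le (not_le.mp h).le
    linarith
  have h1 := abs_lipDiff_mul_log_sq_le hφ hα hx1
  have h2 := sum_selberg_mul_abs_lipDiff_le hφ hα hx1
  have h3 := sum_abs_lipDiff_le_integral hφ hα hx1
  have h4 := integral_abs_lipDiff_le hφ hα (show 0 ≤ Real.log x by linarith)
  set ℓ := Real.log α with hℓ
  have hℓ0 : 0 ≤ ℓ := Real.log_nonneg hα
  set L := Real.log x with hL
  have hL0 : 0 < L := by linarith
  have h5 : ∑ n ∈ Finset.Icc 1 ⌊x⌋₊, Real.log n * |lipDiff φ α (x / n)|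
      ≤ L * ∑ n ∈ Finset.Icc 1 ⌊x⌋₊, |lipDiff φ α (x / n)| := by
    rw [Finset.mul_sum]
    refine Finset.sum_le_sum fun n hn => ?_
    obtain ⟨a, b⟩ := natCast_le_of_mem_Icc_floor hn
    have := Real.log_le_log (by linarith) b
    gcongr
  set R := L ^ (3 / 4 : ℝ) with hR
  have hR1 : 1 ≤ R := Real.one_le_rpow hx (by norm_num)
  set B := (1 + ℓ) * x * (R * L) with hB
  have hxL : x * L ≤ B := by
    have : 1 * x * (1 * L) ≤ (1 + ℓ) * x * (R * L) := by gcongr; linarith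
    linarith
  have hxx : x ≤ x * L := by nlinarith
  have hlx : (2 + ℓ) * x * L ≤ 2 * B := by
    have : (2 + ℓ) * x * (1 * L) ≤ (2 * (1 + ℓ)) * x * (R * L) := by
      gcongr; linarith
    linarith
  have hlx' : (2 + ℓ) * x ≤ (2 + ℓ) * x * L := by
    have : 0 ≤ (2 + ℓ) * x := by positivity
    nlinarith
  have h6 : L * ∑ n ∈ Finset.Icc 1 ⌊x⌋₊, |lipDiff φ α (x / n)|
      ≤ L * (x * (4 + 3204 * (1 + ℓ) * R) + 2 * x + 2) := by
    have := mul_le_mul_of_nonneg_left h4 hx0.le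
    exact mul_le_mul_of_nonneg_left (by linarith) hL0.le
  have h7 : L * (x * (4 + 3204 * (1 + ℓ) * R) + 2 * x + 2) ≤ 3212 * B := by
    have e : L * (x * (4 + 3204 * (1 + ℓ) * R) + 2 * x + 2) = 3204 * B + 6 * (x * L) + 2 * L := by
      rw [hB]; ring
    have : L ≤ x * L := by nlinarith
    rw [e]; linarith
  have h8 : |lipDiff φ α x| * L ^ 2 ≤ 7000 * B := by nlinarith
  have e1 : B = (1 + ℓ) * x * L ^ (-(1 / 4) : ℝ) * L ^ 2 := by
    have : R * L = L ^ (-(1 / 4) : ℝ) * L ^ 2 := by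
      rw [hR, ← Real.rpow_natCast, ← Real.rpow_add hL0]
      nth_rewrite 2 [← Real.rpow_one L]
      rw [← Real.rpow_add hL0]; norm_num
    rw [hB, this]; ring
  rw [e1] at h8
  refine le_of_mul_le_mul_right (h8.trans (le_of_eq ?_)) (pow_pos hL0 2)
  ring

theorem abs_summatory_sub_mul_le {φ : ℕ →*₀ ℝ} (hφ : ∀ n, |φ n| ≤ 1) {x t K : ℝ}
    (ht : 0 < t) (htx : t ≤ x) (hx : 1 ≤ Real.log x) (hK : x ≤ K * t) :
    |summatory φ t - t / x * summatory φ x|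
      ≤ 7000 * (1 + Real.log K) * Real.log x ^ (-(1 / 4) : ℝ) * t := by
  have hx0 : 0 < x := ht.trans_le htx
  have hα : 1 ≤ x / t := by rwa [one_le_div ht]
  have h := abs_lipDiff_le_mul_rpow_log hφ hα hx hx0
  have e : summatory φ t - t / x * summatory φ x = -(t / x * lipDiff φ (x / t) x) := by
    rw [lipDiff, div_div_cancel₀ hx0.ne']
    field_simp; ring
  have hlog : Real.log (x / t) ≤ Real.log K :=
    Real.log_le_log (by positivity) (by rwa [div_le_iff₀ ht])
  have hR : 0 ≤ Real.log x ^ (-(1 / 4) : ℝ) := Real.rpow_nonneg (by linarith) _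
  rw [e, abs_neg, abs_mul, abs_of_pos (by positivity : 0 < t / x)]
  calc _ ≤ t / x * (7000 * (1 + Real.log (x / t)) * x * Real.log x ^ (-(1 / 4) : ℝ)) := by gcongr
    _ ≤ t / x * (7000 * (1 + Real.log K) * x * Real.log x ^ (-(1 / 4) : ℝ)) := by gcongr
    _ = _ := by field_simp

open MeasureTheory in
theorem sum_Ioc_mul_div_sub_eq (φ : ℕ →*₀ ℝ) {x j : ℝ} (hx : 0 < x) (hj : 0 < j) :
    ∑ d ∈ Finset.Ioc ⌊x / (j + 1)⌋₊ ⌊x / j⌋₊, φ d * (x / d - j)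
      = -summatory φ (x / (j + 1))
        + ∫ t in (x / (j + 1))..(x / j), x / t ^ 2 * summatory φ t := by
  have ha : 0 < x / (j + 1) := by positivity
  have hab : x / (j + 1) ≤ x / j := by gcongr; linarith
  have hd : ∀ t : ℝ, 0 < t → HasDerivAt (fun t => x / t - j) (-(x / t ^ 2)) t := by
    intro t ht
    have := ((hasDerivAt_inv ht.ne').const_mul x).sub_const j
    simpa only [div_eq_mul_inv, Pi.inv_apply, one_mul, mul_neg, neg_mul] using this
  have hc : ContinuousOn (fun t : ℝ => -(x / t ^ 2)) (Set.Icc (x / (j + 1)) (x / j)) := by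
    refine (continuousOn_const.div (by fun_prop) fun t ht => ?_).neg
    have : 0 < t := ha.trans_le ht.1
    positivity
  have hde : Set.EqOn (deriv fun t => x / t - j) (fun t : ℝ => -(x / t ^ 2))
      (Set.Icc (x / (j + 1)) (x / j)) := fun t ht => (hd t (ha.trans_le ht.1)).deriv
  have h := sum_mul_eq_sub_sub_integral_mul (𝕜 := ℝ) (fun n => φ n) (f := fun t => x / t - j)
    ha.le hab (fun t ht => (hd t (ha.trans_le ht.1)).differentiableAt)
    ((hc.integrableOn_Icc).congr_fun (fun t ht => (hde ht).symm) measurableSet_Icc)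
  have hS : ∀ t : ℝ, ∑ k ∈ Finset.Icc 0 ⌊t⌋₊, φ k = summatory φ t := by
    intro t
    rw [summatory, ← Finset.add_sum_Ioc_eq_sum_Icc (Nat.zero_le _), map_zero, zero_add]
    rfl
  have e : ∑ d ∈ Finset.Ioc ⌊x / (j + 1)⌋₊ ⌊x / j⌋₊, φ d * (x / d - j)
      = ∑ d ∈ Finset.Ioc ⌊x / (j + 1)⌋₊ ⌊x / j⌋₊, (x / d - j) * φ d :=
    Finset.sum_congr rfl fun d _ => mul_comm _ _
  rw [e, h]
  simp only [hS]
  rw [div_div_cancel₀ hx.ne', div_div_cancel₀ hx.ne', intervalIntegral.integral_of_le hab,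
    setIntegral_congr_fun (g := fun t => -(x / t ^ 2 * summatory φ t)) measurableSet_Ioc,
    integral_neg]
  · ring
  · intro t ht
    simp only
    rw [hde ⟨ht.1.le, ht.2⟩]
    ring

open MeasureTheory in
theorem abs_sum_Ioc_mul_div_sub_sub_le {φ : ℕ →*₀ ℝ} (hφ : ∀ n, |φ n| ≤ 1) {x j : ℝ}
    (hx : 1 ≤ Real.log x) (hx0 : 0 < x) (hj : 1 ≤ j) :
    |∑ d ∈ Finset.Ioc ⌊x / (j + 1)⌋₊ ⌊x / j⌋₊, φ d * (x / d - j)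
        - summatory φ x * (Real.log ((j + 1) / j) - 1 / (j + 1))|
      ≤ 7000 * (1 + Real.log (j + 1)) * Real.log x ^ (-(1 / 4) : ℝ) * (2 * x / j) := by
  have hj0 : 0 < j := by linarith
  have ha : 0 < x / (j + 1) := by positivity
  have hab : x / (j + 1) ≤ x / j := by gcongr; linarith
  have hbx : x / j ≤ x := div_le_self hx0.le hj
  have hR : 0 ≤ Real.log x ^ (-(1 / 4) : ℝ) := Real.rpow_nonneg (by linarith) _
  have hlj : 0 ≤ Real.log (j + 1) := Real.log_nonneg (by linarith)
  set M := 7000 * (1 + Real.log (j + 1)) * Real.log x ^ (-(1 / 4) : ℝ) with hM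
  have hM0 : 0 ≤ M := by positivity
  have bound : ∀ t ∈ Set.Icc (x / (j + 1)) (x / j),
      |summatory φ t - t / x * summatory φ x| ≤ M * t := by
    intro t ht
    refine abs_summatory_sub_mul_le hφ (ha.trans_le ht.1) (ht.2.trans hbx) hx ?_
    have := ht.1
    rw [div_le_iff₀ (by linarith)] at this
    linarith
  have hne : ∀ t ∈ Set.uIcc (x / (j + 1)) (x / j), t ≠ 0 := by
    intro t ht
    rw [Set.uIcc_of_le hab] at ht
    exact (ha.trans_le ht.1).ne'
  have hci : IntervalIntegrable (fun t : ℝ => x / t ^ 2) volume (x / (j + 1)) (x / j) :=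
    ContinuousOn.intervalIntegrable
      (continuousOn_const.div (by fun_prop) fun t ht => pow_ne_zero 2 (hne t ht))
  have hinv : IntervalIntegrable (fun t : ℝ => t⁻¹) volume (x / (j + 1)) (x / j) :=
    ContinuousOn.intervalIntegrable (continuousOn_id.inv₀ hne)
  have hSi : IntervalIntegrable (fun t : ℝ => x / t ^ 2 * summatory φ t) volume
      (x / (j + 1)) (x / j) := by
    refine (hinv.const_mul x).mono_fun' (((measurable_const.div
      (measurable_id.pow_const 2)).mul (measurable_summatory φ)).aestronglyMeasurable) ?_
    rw [Set.uIoc_of_le hab]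
    refine (ae_restrict_iff' measurableSet_Ioc).mpr (.of_forall fun t ht => ?_)
    have ht0 : 0 < t := ha.trans ht.1
    simp only
    rw [norm_mul, Real.norm_of_nonneg (by positivity)]
    calc _ ≤ x / t ^ 2 * t := by gcongr; exact abs_summatory_le hφ ht0.le
      _ = _ := by field_simp
  have hlog : ∫ t in (x / (j + 1))..(x / j), t⁻¹ = Real.log ((j + 1) / j) := by
    rw [integral_inv_of_pos ha (by positivity)]
    congr 1
    field_simp
  have hmain : ∫ t in (x / (j + 1))..(x / j), (x / t ^ 2 * summatory φ t - summatory φ x * t⁻¹)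
      = (∫ t in (x / (j + 1))..(x / j), x / t ^ 2 * summatory φ t)
        - summatory φ x * Real.log ((j + 1) / j) := by
    rw [intervalIntegral.integral_sub hSi (hinv.const_mul _), intervalIntegral.integral_const_mul,
      hlog]
  have herr : |∫ t in (x / (j + 1))..(x / j),
      (x / t ^ 2 * summatory φ t - summatory φ x * t⁻¹)| ≤ M * x * Real.log ((j + 1) / j) := by
    rw [← hlog, ← intervalIntegral.integral_const_mul, ← Real.norm_eq_abs]
    refine intervalIntegral.norm_integral_le_of_norm_le hab (.of_forall fun t ht => ?_)
      (hinv.const_mul _)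
    have ht0 : 0 < t := ha.trans ht.1
    have e : x / t ^ 2 * summatory φ t - summatory φ x * t⁻¹
        = x / t ^ 2 * (summatory φ t - t / x * summatory φ x) := by field_simp
    rw [e, norm_mul, Real.norm_of_nonneg (by positivity)]
    calc _ ≤ x / t ^ 2 * (M * t) := by gcongr; exact bound t ⟨ht.1.le, ht.2⟩
      _ = _ := by field_simp
  have h1 := bound _ ⟨le_rfl, hab⟩
  have e1 : x / (j + 1) / x = 1 / (j + 1) := by field_simp
  rw [e1] at h1
  rw [hmain] at herr
  rw [sum_Ioc_mul_div_sub_eq φ hx0 hj0]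
  have h2 : Real.log ((j + 1) / j) ≤ 1 / j := by
    refine (Real.log_le_sub_one_of_pos (by positivity)).trans (le_of_eq ?_)
    field_simp; ring
  have h3 : M * x * Real.log ((j + 1) / j) ≤ M * (x / j) := by
    calc _ ≤ M * x * (1 / j) := by gcongr
      _ = _ := by ring
  have h4 : M * (x / (j + 1)) ≤ M * (x / j) := by gcongr
  have e2 : M * (2 * x / j) = M * (x / j) + M * (x / j) := by ring
  rw [e2]
  rw [abs_le] at h1 herr ⊢
  constructor <;> linarith

theorem sum_Icc_floor_eq_add_sum_blocks (g : ℕ → ℝ) {x : ℝ} (hx : 0 ≤ x) (J : ℕ) :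
    ∑ d ∈ Finset.Icc 1 ⌊x⌋₊, g d = ∑ d ∈ Finset.Icc 1 ⌊x / (J + 1)⌋₊, g d
      + ∑ j ∈ Finset.Icc 1 J, ∑ d ∈ Finset.Ioc ⌊x / (j + 1)⌋₊ ⌊x / j⌋₊, g d := by
  induction J with
  | zero => simp
  | succ J ih =>
    rw [ih, Finset.sum_Icc_succ_top (by omega)]
    push_cast
    have hle : ⌊x / (J + 1 + 1 : ℝ)⌋₊ ≤ ⌊x / (J + 1 : ℝ)⌋₊ := by
      apply Nat.floor_mono; gcongr; linarith
    have h := Finset.sum_Ioc_consecutive g (Nat.zero_le _) hle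
    have e : ∀ N, Finset.Ioc 0 N = Finset.Icc 1 N := fun N => rfl
    rw [e, e] at h
    rw [← h]; ring

theorem fract_div_eq_of_mem_Ioc {x : ℝ} {j d : ℕ} (hj : 1 ≤ j)
    (hd : d ∈ Finset.Ioc ⌊x / (j + 1)⌋₊ ⌊x / j⌋₊) : Int.fract (x / d) = x / d - j := by
  obtain ⟨h1, h2⟩ := Finset.mem_Ioc.mp hd
  have hd0 : d ≠ 0 := by omega
  have hdp : (0 : ℝ) < d := by positivity
  have hjp : (0 : ℝ) < j := by exact_mod_cast hj
  rw [Nat.floor_lt' hd0, div_lt_iff₀ (by positivity)] at h1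
  rw [Nat.le_floor_iff' hd0, le_div_iff₀ hjp] at h2
  rw [Int.fract, sub_right_inj]
  have : ⌊x / d⌋ = (j : ℤ) := by
    rw [Int.floor_eq_iff]
    push_cast
    rw [le_div_iff₀ hdp, div_lt_iff₀ hdp]
    constructor <;> linarith
  rw [this]; simp

theorem abs_sum_mul_fract_sub_le {φ : ℕ →*₀ ℝ} (hφ : ∀ n, |φ n| ≤ 1) {x : ℝ}
    (hx : 1 ≤ Real.log (Real.log x)) (hx1 : 1 ≤ x) :
    |(∑ d ∈ Finset.Icc 1 ⌊x⌋₊, φ d * Int.fract (x / d))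
        - summatory φ x * ∑ j ∈ Finset.Icc 1 ⌊Real.log x⌋₊,
            (Real.log ((j + 1 : ℝ) / j) - 1 / (j + 1))|
      ≤ 84001 * x * Real.log (Real.log x) ^ 2 / Real.log x ^ ((1 : ℝ) / 4) := by
  have hx0 : 0 < x := by linarith
  have hL0 : 0 ≤ Real.log x := Real.log_nonneg hx1
  have hL1 : 1 ≤ Real.log x := by
    by_contra h
    have := Real.log_nonpos hL0 (not_le.mp h).le
    linarith
  set L := Real.log x with hL
  set J := ⌊L⌋₊ with hJ
  have hJL : (J : ℝ) ≤ L := Nat.floor_le hL0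
  have hLJ : L < J + 1 := Nat.lt_floor_add_one L
  set R := L ^ (-(1 / 4) : ℝ) with hR
  have hR0 : 0 ≤ R := Real.rpow_nonneg hL0 _
  have htail : |∑ d ∈ Finset.Icc 1 ⌊x / (J + 1)⌋₊, φ d * Int.fract (x / d)| ≤ x * R := by
    have h1 : |∑ d ∈ Finset.Icc 1 ⌊x / (J + 1)⌋₊, φ d * Int.fract (x / d)| ≤ x / (J + 1) := by
      refine (Finset.abs_sum_le_sum_abs _ _).trans
        ((Finset.sum_le_card_nsmul _ _ 1 fun d _ => ?_).trans ?_)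
      · rw [abs_mul, abs_of_nonneg (Int.fract_nonneg (x / d))]
        exact mul_le_one₀ (hφ d) (Int.fract_nonneg _) (Int.fract_lt_one _).le
      · simpa using Nat.floor_le (show 0 ≤ x / (J + 1 : ℝ) by positivity)
    have h2 : x / (J + 1) ≤ x * L ^ (-1 : ℝ) := by
      rw [Real.rpow_neg_one, ← div_eq_mul_inv]
      gcongr
    have h3 : L ^ (-1 : ℝ) ≤ R := Real.rpow_le_rpow_of_exponent_le hL1 (by norm_num)
    have := mul_le_mul_of_nonneg_left h3 hx0.le
    linarith
  have hblock : ∀ j ∈ Finset.Icc 1 J,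
      |∑ d ∈ Finset.Ioc ⌊x / (j + 1)⌋₊ ⌊x / j⌋₊, φ d * Int.fract (x / d)
        - summatory φ x * (Real.log ((j + 1 : ℝ) / j) - 1 / (j + 1))|
      ≤ 14000 * (2 + Real.log L) * R * x * (j : ℝ)⁻¹ := by
    intro j hj
    obtain ⟨hj1, hj2⟩ := Finset.mem_Icc.mp hj
    have hj1' : (1 : ℝ) ≤ j := by exact_mod_cast hj1
    have hjL : (j : ℝ) ≤ L := (by exact_mod_cast hj2 : (j : ℝ) ≤ J).trans hJL
    have e : ∑ d ∈ Finset.Ioc ⌊x / (j + 1)⌋₊ ⌊x / j⌋₊, φ d * Int.fract (x / d)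
        = ∑ d ∈ Finset.Ioc ⌊x / (j + 1)⌋₊ ⌊x / j⌋₊, φ d * (x / d - j) :=
      Finset.sum_congr rfl fun d hd => by rw [fract_div_eq_of_mem_Ioc hj1 hd]
    rw [e]
    refine (abs_sum_Ioc_mul_div_sub_sub_le hφ hL1 hx0 hj1').trans ?_
    have hl : Real.log (j + 1) ≤ 1 + Real.log L := by
      have h1 : Real.log (j + 1) ≤ Real.log (2 * L) :=
        Real.log_le_log (by positivity) (by linarith)
      rw [Real.log_mul (by norm_num) (by linarith)] at h1
      linarith [Real.log_two_lt_d9]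
    calc _ ≤ 7000 * (1 + (1 + Real.log L)) * R * (2 * x / j) := by gcongr
      _ = _ := by ring
  have hsum : ∑ j ∈ Finset.Icc 1 J, 14000 * (2 + Real.log L) * R * x * (j : ℝ)⁻¹
      ≤ 14000 * (2 + Real.log L) * R * x * (1 + Real.log L) := by
    rw [← Finset.mul_sum]
    gcongr
    exact sum_inv_le_one_add_log hL1
  rw [sum_Icc_floor_eq_add_sum_blocks _ hx0.le J, Finset.mul_sum, add_sub_assoc,
    ← Finset.sum_sub_distrib]
  refine (abs_add_le _ _).trans ?_
  have h1 := (Finset.abs_sum_le_sum_abs _ _).trans ((Finset.sum_le_sum hblock).trans hsum)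
  have e : 84001 * x * Real.log L ^ 2 / L ^ ((1 : ℝ) / 4) = 84001 * Real.log L ^ 2 * (x * R) := by
    rw [hR, Real.rpow_neg hL0, ← div_eq_mul_inv]; ring
  rw [e]
  have hxR : 0 ≤ x * R := by positivity
  have h2 : (2 + Real.log L) * (1 + Real.log L) ≤ 6 * Real.log L ^ 2 := by nlinarith
  have h3 : 14000 * (2 + Real.log L) * R * x * (1 + Real.log L)
      ≤ 84000 * Real.log L ^ 2 * (x * R) := by
    have := mul_le_mul_of_nonneg_right h2 hxR
    linarith
  have h4 : x * R ≤ Real.log L ^ 2 * (x * R) := by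
    have : 1 ≤ Real.log L ^ 2 := one_le_pow₀ hx
    exact le_mul_of_one_le_left hxR this
  linarith

/-- The extension by `0` of a completely multiplicative function to a morphism on `ℕ`. -/
noncomputable def IsComplMult.toMonoidWithZeroHom {f : ℕ → ℝ} (hf : IsComplMult f) : ℕ →*₀ ℝ where
  toFun n := if n = 0 then 0 else f n
  map_zero' := by simp
  map_one' := by simpa using hf.1
  map_mul' m n := by
    rcases Nat.eq_zero_or_pos m with rfl | hm
    · simp
    rcases Nat.eq_zero_or_pos n with rfl | hn
    · simp
    simp [hm.ne', hn.ne', hf.2 m n hm hn]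

theorem IsComplMult.toMonoidWithZeroHom_apply {f : ℕ → ℝ} (hf : IsComplMult f) {n : ℕ}
    (hn : n ≠ 0) : hf.toMonoidWithZeroHom n = f n := if_neg hn

/-- estimate (3.4):
`∑_{d ≤ x} f d {x/d} = (∑_{n ≤ x} f n) ∑_{j ≤ log x} (log((j+1)/j) - 1/(j+1))
  + O(x (log log x)² / (log x)^{1/4})`. -/
theorem fractional_part_sum_estimate :
    ∃ C x₀ : ℝ, ∀ x : ℝ, x₀ ≤ x →
      ∀ f : ℕ → ℝ, IsComplMult f → (∀ n : ℕ, 0 < n → -1 ≤ f n ∧ f n ≤ 1) →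
        |(∑ d ∈ Finset.Icc 1 ⌊x⌋₊, f d * Int.fract (x / d))
            - (∑ n ∈ Finset.Icc 1 ⌊x⌋₊, f n) *
                ∑ j ∈ Finset.Icc 1 ⌊Real.log x⌋₊,
                  (Real.log ((j + 1 : ℝ) / j) - 1 / (j + 1))|
          ≤ C * x * (Real.log (Real.log x)) ^ 2 / (Real.log x) ^ ((1 : ℝ) / 4) := by
  refine ⟨84001, Real.exp (Real.exp 1), fun x hx f hf hb => ?_⟩
  have hx0 : 0 < x := (Real.exp_pos _).trans_le hx
  have h1 : Real.exp 1 ≤ Real.log x := (Real.le_log_iff_exp_le hx0).mpr hx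
  have h2 : 1 ≤ Real.log (Real.log x) :=
    (Real.le_log_iff_exp_le ((Real.exp_pos 1).trans_le h1)).mpr h1
  have hφ : ∀ n, |hf.toMonoidWithZeroHom n| ≤ 1 := by
    intro n
    rcases Nat.eq_zero_or_pos n with rfl | hn
    · simp
    · rw [hf.toMonoidWithZeroHom_apply hn.ne']
      exact abs_le.mpr (hb n hn)
  have h := abs_sum_mul_fract_sub_le hφ h2
    ((Real.one_le_exp (Real.exp_pos 1).le).trans hx)
  have e : ∀ n ∈ Finset.Icc 1 ⌊x⌋₊, hf.toMonoidWithZeroHom n = f n := fun n hn =>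
    hf.toMonoidWithZeroHom_apply (by have := (Finset.mem_Icc.mp hn).1; omega)
  rw [summatory, Finset.sum_congr rfl e,
    Finset.sum_congr rfl fun d hd => by rw [e d hd]] at h
  exact h
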